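/- Assume the Riemann Hypothesis. For every pair {γ₁, γ₂} of two distinct simple zeros of Hardy's Z-function, the value ĝ_{γ₁,γ₂} is strictly positive. -/

import Mathlib

open Complex

/-- The Riemann–Siegel theta function
`ϑ(t) = (1/(2i)) log (Γ(1/4+it/2)/Γ(1/4−it/2)) − (t/2) log π` (real-valued for real `t`). -/
noncomputable def RStheta (t : ℝ) : ℝ :=
  (1 / (2 * Complex.I) * Complex.log (Complex.Gamma (1 / 4 + Complex.I * t / 2) /
      Complex.Gamma (1 / 4 - Complex.I * t / 2))).re - t / 2 * Real.log Real.pi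

/-- Hardy's Z-function `Z(t) = e^{iϑ(t)} ζ(1/2+it)` (real-valued for real `t`). -/
noncomputable def HardyZ (t : ℝ) : ℝ :=
  (Complex.exp (Complex.I * RStheta t) * riemannZeta (1 / 2 + Complex.I * t)).re

/-- `γ` is a simple zero of Hardy's Z-function. -/
def IsSimpleZeroZ (γ : ℝ) : Prop := HardyZ γ = 0 ∧ deriv HardyZ γ ≠ 0

/-- `F̂(t) = −(Z'''/Z')(t) + (3/4)((Z''/Z')(t))²`. -/
noncomputable def Fhat (t : ℝ) : ℝ :=
  -(iteratedDeriv 3 HardyZ t / deriv HardyZ t) +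
    3 / 4 * (iteratedDeriv 2 HardyZ t / deriv HardyZ t) ^ 2

/-- `ĝ_{γ₁,γ₂} = (1/3)(γ₁−γ₂)²(F̂(γ₁)+F̂(γ₂)) − 2`. -/
noncomputable def ghat (γ₁ γ₂ : ℝ) : ℝ :=
  1 / 3 * (γ₁ - γ₂) ^ 2 * (Fhat γ₁ + Fhat γ₂) - 2

/-- `ḡ_{γ₁,γ₂} = (γ₁−γ₂)² Σ_{γ∉{γ₁,γ₂}} [1/(γ−γ₁)² + 1/(γ−γ₂)²]`, the sum running over
all zeros `γ` of the Z-function other than `γ₁, γ₂`. -/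
noncomputable def gbar (γ₁ γ₂ : ℝ) : ℝ :=
  (γ₁ - γ₂) ^ 2 * ∑' γ : {γ : ℝ // HardyZ γ = 0 ∧ γ ≠ γ₁ ∧ γ ≠ γ₂},
    (1 / ((γ : ℝ) - γ₁) ^ 2 + 1 / ((γ : ℝ) - γ₂) ^ 2)

/-- A Lehmer pair: a pair `γ₋ < γ₊` of consecutive simple (positive) zeros of the
Z-function with `ḡ_{γ₋,γ₊} < 4/5`. -/
def IsLehmerPair (γm γp : ℝ) : Prop :=
  0 < γm ∧ γm < γp ∧ IsSimpleZeroZ γm ∧ IsSimpleZeroZ γp ∧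
    (∀ t : ℝ, γm < t → t < γp → HardyZ t ≠ 0) ∧ gbar γm γp < 4 / 5

section

open Filter Topology ComplexConjugate

/-! ### Factoring out zeros of an entire function -/

lemma exists_entire_pow_mul {Y : ℂ → ℂ} (hY : Differentiable ℂ Y) {a : ℂ}
    (ha : analyticOrderAt Y a ≠ ⊤) :
    ∃ g : ℂ → ℂ, Differentiable ℂ g ∧ g a ≠ 0 ∧
      ∀ z, Y z = (z - a) ^ analyticOrderNatAt Y a * g z := by
  classical
  obtain ⟨g₀, hg₀, hne, heq⟩ := (hY.analyticAt a).analyticOrderAt_ne_top.1 ha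
  set n := analyticOrderNatAt Y a
  refine ⟨fun z => if z = a then g₀ a else Y z / (z - a) ^ n, fun z => ?_, by simpa using hne,
    fun z => ?_⟩
  · rcases eq_or_ne z a with rfl | hz
    · refine hg₀.differentiableAt.congr_of_eventuallyEq ?_
      filter_upwards [heq] with w hw
      split_ifs with h
      · rw [h]
      · rw [hw, smul_eq_mul, mul_div_cancel_left₀ _ (pow_ne_zero _ (sub_ne_zero.2 h))]
    · have : DifferentiableAt ℂ (fun z => Y z / (z - a) ^ n) z :=
        (hY z).div (by fun_prop) (pow_ne_zero _ (sub_ne_zero.2 hz))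
      refine this.congr_of_eventuallyEq ?_
      filter_upwards [isOpen_ne.mem_nhds hz] with w hw
      simp [show w ≠ a from hw]
  · rcases eq_or_ne z a with rfl | hz
    · simpa using heq.self_of_nhds
    · simp only [hz, if_false]
      rw [mul_div_cancel₀ _ (pow_ne_zero _ (sub_ne_zero.2 hz))]

lemma analyticOrderAt_ne_top_of_entire {Y : ℂ → ℂ} (hY : Differentiable ℂ Y) {b : ℂ}
    (hb : Y b ≠ 0) (z : ℂ) : analyticOrderAt Y z ≠ ⊤ := by
  refine AnalyticOnNhd.analyticOrderAt_ne_top_of_isPreconnected (U := Set.univ) (x := b)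
    (fun w _ => hY.analyticAt w) isPreconnected_univ (Set.mem_univ _) (Set.mem_univ _) ?_
  rw [(hY.analyticAt b).analyticOrderAt_eq_zero.2 hb]
  exact ENat.zero_ne_top

lemma exists_entire_prod_mul {Y : ℂ → ℂ} (hY : Differentiable ℂ Y) {b : ℂ} (hb : Y b ≠ 0)
    (S : Finset ℂ) :
    ∃ g : ℂ → ℂ, Differentiable ℂ g ∧ (∀ ρ ∈ S, g ρ ≠ 0) ∧
      ∀ z, Y z = (∏ ρ ∈ S, (z - ρ) ^ analyticOrderNatAt Y ρ) * g z := by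
  classical
  induction S using Finset.induction_on with
  | empty => exact ⟨Y, hY, by simp, by simp⟩
  | insert a S ha ih =>
    obtain ⟨g, hg, hgS, heq⟩ := ih
    set P : ℂ → ℂ := fun z => ∏ ρ ∈ S, (z - ρ) ^ analyticOrderNatAt Y ρ
    have hP : Differentiable ℂ P := by fun_prop
    have hPa : P a ≠ 0 := Finset.prod_ne_zero_iff.2 fun ρ hρ =>
      pow_ne_zero _ (sub_ne_zero.2 fun h => ha (h ▸ hρ))
    have hord : analyticOrderAt g a = analyticOrderAt Y a := by
      have : Y = P * g := funext heq
      rw [this, analyticOrderAt_mul (hP.analyticAt a) (hg.analyticAt a),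
        (hP.analyticAt a).analyticOrderAt_eq_zero.2 hPa, zero_add]
    obtain ⟨k, hk, hka, hkeq⟩ := exists_entire_pow_mul hg
      (hord ▸ analyticOrderAt_ne_top_of_entire hY hb a)
    have hn : analyticOrderNatAt g a = analyticOrderNatAt Y a := by
      simp only [analyticOrderNatAt, hord]
    refine ⟨k, hk, fun ρ hρ => ?_, fun z => ?_⟩
    · rcases Finset.mem_insert.1 hρ with rfl | hρ
      · exact hka
      · intro h
        exact hgS ρ hρ (by rw [hkeq, h, mul_zero])
    · rw [Finset.prod_insert ha, heq z, hkeq z, hn]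
      ring

lemma exists_finset_zeros_closedBall {Y : ℂ → ℂ} (hY : Differentiable ℂ Y) {b : ℂ} (hb : Y b ≠ 0)
    (c : ℂ) (R : ℝ) : ∃ S : Finset ℂ, ∀ z, z ∈ S ↔ ‖z - c‖ ≤ R ∧ Y z = 0 := by
  have hfin : (Metric.closedBall c R ∩ Y ⁻¹' {0}).Finite := by
    by_contra hinf
    obtain ⟨z₀, -, hacc⟩ := Set.Infinite.exists_accPt_of_subset_isCompact hinf
      (isCompact_closedBall c R) Set.inter_subset_left
    have hfreq : ∃ᶠ z in nhdsWithin z₀ {z₀}ᶜ, Y z = 0 :=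
      (accPt_iff_frequently_nhdsNE.1 hacc).mono fun z hz => hz.2
    exact hb (AnalyticOnNhd.eqOn_zero_of_preconnected_of_frequently_eq_zero (U := Set.univ)
      (fun w _ => hY.analyticAt w) isPreconnected_univ (Set.mem_univ z₀) hfreq (Set.mem_univ b))
  refine ⟨hfin.toFinset, fun z => ?_⟩
  simp [dist_eq_norm]

lemma norm_deriv_logDeriv_le {g : ℂ → ℂ} (hg : Differentiable ℂ g) {b : ℂ} {R M : ℝ} (hR : 0 < R)
    (hM : 0 < M) (hne : ∀ z, ‖z - b‖ < R → g z ≠ 0)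
    (hbd : ∀ z, ‖z - b‖ < R → ‖g z‖ ≤ ‖g b‖ * Real.exp M) {z : ℂ} (hz : ‖z - b‖ ≤ R / 4) :
    ‖deriv (logDeriv g) z‖ ≤ 64 * M / R ^ 2 := by
  have hmem : ∀ w, w ∈ Metric.ball b R ↔ ‖w - b‖ < R := fun w => by
    rw [Metric.mem_ball, dist_eq_norm]
  have hld : DifferentiableOn ℂ (logDeriv g) (Metric.ball b R) := fun w hw =>
    ((hg.deriv w).div (hg w) (hne w ((hmem w).1 hw))).differentiableWithinAt
  obtain ⟨l, hlb, hl⟩ := (DifferentiableOn.isExactOn_ball hld).with_val_at b 0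
  have hb : b ∈ Metric.ball b R := Metric.mem_ball_self hR
  have hconst : ∀ w ∈ Metric.ball b R, g w * exp (-l w) = g b := by
    intro w hw
    have hd : ∀ x ∈ Metric.ball b R, HasDerivAt (fun x => g x * exp (-l x)) 0 x := by
      intro x hx
      have := (hg x).hasDerivAt.mul ((hl x hx).neg.cexp)
      refine this.congr_deriv ?_
      have := hne x ((hmem x).1 hx)
      rw [logDeriv_apply, Pi.neg_apply]
      field_simp
      ring
    have := (convex_ball b R).is_const_of_fderivWithin_eq_zero (𝕜 := ℂ)
      (f := fun x => g x * exp (-l x))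
      (fun x hx => (hd x hx).differentiableAt.differentiableWithinAt) (fun x hx => by
        rw [fderivWithin_of_isOpen Metric.isOpen_ball hx]
        ext
        simp [(hd x hx).deriv]) hw hb
    simpa [hlb] using this
  have hre : ∀ w ∈ Metric.ball b R, (l w).re ≤ M := by
    intro w hw
    have h1 := hbd w ((hmem w).1 hw)
    have h2 : g w = g b * exp (l w) := by
      rw [← hconst w hw, mul_assoc, ← exp_add]; simp
    rw [h2, norm_mul, norm_exp] at h1
    exact Real.exp_le_exp.1 (le_of_mul_le_mul_left h1 (norm_pos_iff.2 (hne b ((hmem b).1 hb))))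
  have hldiff : DifferentiableOn ℂ l (Metric.ball b R) := fun w hw =>
    (hl w hw).differentiableAt.differentiableWithinAt
  have hlbd : ∀ w, ‖w - b‖ ≤ R / 2 → ‖l w‖ ≤ 2 * M := by
    intro w hw
    have hmaps : Set.MapsTo (fun x : ℂ => b + x) (Metric.ball 0 R) (Metric.ball b R) := by
      intro x hx
      rw [hmem]; simpa using hx
    have h := borelCaratheodory_zero (f := fun x => l (b + x)) (R := R) (z := w - b) hM
      (hldiff.comp (by fun_prop) hmaps) (fun x hx => hre _ (hmaps hx)) hR
      (by rw [mem_ball_zero_iff]; linarith) (by simpa using hlb)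
    simp only [add_sub_cancel] at h
    refine h.trans ?_
    rw [div_le_iff₀ (by linarith)]
    have : 2 * M * ‖w - b‖ ≤ 2 * M * (R - ‖w - b‖) := by gcongr; linarith
    exact this
  have hsub : Metric.closedBall z (R / 4) ⊆ Metric.ball b R := fun w hw => by
    rw [hmem]
    rw [Metric.mem_closedBall, dist_eq_norm] at hw
    have := norm_add_le (w - z) (z - b)
    rw [sub_add_sub_cancel] at this
    linarith
  have hC := norm_iteratedDeriv_le_of_forall_mem_sphere_norm_le (f := l) (c := z) (R := R / 4)
    (C := 2 * M) 2 (by positivity)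
    ((hldiff.mono hsub).diffContOnCl_ball subset_rfl) (fun w hw => by
      refine hlbd w ?_
      rw [mem_sphere_iff_norm] at hw
      have := norm_add_le (w - z) (z - b)
      rw [sub_add_sub_cancel] at this
      linarith)
  have hev : deriv l =ᶠ[nhds z] logDeriv g := by
    filter_upwards [Metric.isOpen_ball.mem_nhds ((hmem z).2 (by linarith : ‖z - b‖ < R))] with w hw
    exact (hl w hw).deriv
  have h2 : iteratedDeriv 2 l z = deriv (logDeriv g) z := by
    rw [iteratedDeriv_succ, iteratedDeriv_one]
    exact hev.deriv_eq
  rw [h2] at hC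
  refine hC.trans (le_of_eq ?_)
  rw [show (Nat.factorial 2 : ℝ) = 2 by norm_num [Nat.factorial]]
  field_simp
  ring

lemma norm_le_of_prod_factor {Y g : ℂ → ℂ} (hg : Differentiable ℂ g) {b : ℂ} (hb : Y b ≠ 0)
    {R M : ℝ} (hR : 0 < R) {S : Finset ℂ} (hS : ∀ ρ ∈ S, ‖ρ - b‖ ≤ R) {m : ℂ → ℕ}
    (hfac : ∀ z, Y z = (∏ ρ ∈ S, (z - ρ) ^ m ρ) * g z)
    (hbd : ∀ z, ‖z - b‖ = 2 * R → ‖Y z‖ ≤ ‖Y b‖ * Real.exp M) {z : ℂ} (hz : ‖z - b‖ < R) :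
    ‖g z‖ ≤ ‖g b‖ * Real.exp M := by
  refine norm_le_of_forall_mem_frontier_norm_le (U := Metric.ball b (2 * R)) Metric.isBounded_ball
    hg.diffContOnCl (fun w hw => ?_) (subset_closure ?_)
  · rw [frontier_ball b (by positivity), mem_sphere_iff_norm] at hw
    have h := hbd w hw
    rw [hfac w, hfac b, norm_mul, norm_mul] at h
    have hPb : (∏ ρ ∈ S, (b - ρ) ^ m ρ) ≠ 0 := fun h0 => hb (by rw [hfac, h0, zero_mul])
    have hP : ‖∏ ρ ∈ S, (b - ρ) ^ m ρ‖ ≤ ‖∏ ρ ∈ S, (w - ρ) ^ m ρ‖ := by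
      rw [norm_prod, norm_prod]
      refine Finset.prod_le_prod (fun _ _ => norm_nonneg _) fun ρ hρ => ?_
      rw [norm_pow, norm_pow]
      gcongr
      have h1 := hS ρ hρ
      have h2 := norm_sub_le_norm_sub_add_norm_sub w ρ b
      rw [norm_sub_rev b ρ]
      linarith
    refine le_of_mul_le_mul_left ?_ (norm_pos_iff.2 hPb)
    calc _ ≤ ‖∏ ρ ∈ S, (w - ρ) ^ m ρ‖ * ‖g w‖ := by gcongr
      _ ≤ _ := by rw [← mul_assoc]; exact h
  · rw [Metric.mem_ball, dist_eq_norm]; linarith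

/-- Finite factorizations of an entire function with real zeros along an exhausting sequence of
symmetric sets of zeros, such that the cofactors have asymptotically constant logarithmic
derivative. -/
structure RealZeroFactorization (X : ℂ → ℂ) where
  /-- The finite sets of zeros. -/
  S : ℕ → Finset ℝ
  /-- The cofactors. -/
  g : ℕ → ℂ → ℂ
  /-- The bounds for the second logarithmic derivatives of the cofactors. -/
  ε : ℕ → ℝ
  tendsto_ε : Tendsto ε atTop (𝓝 0)
  neg_mem : ∀ n, ∀ ρ ∈ S n, -ρ ∈ S n
  eventually_mem : ∀ ρ : ℝ, X ρ = 0 → ∀ᶠ n in atTop, ρ ∈ S n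
  differentiable_g : ∀ n, Differentiable ℂ (g n)
  eq_prod_mul : ∀ n z, X z = (∏ ρ ∈ S n, (z - ρ) ^ analyticOrderNatAt X ρ) * g n z
  eventually_bound : ∀ r : ℝ, ∀ᶠ n in atTop, ∀ z : ℂ, ‖z‖ ≤ r →
    g n z ≠ 0 ∧ ‖deriv (logDeriv (g n)) z‖ ≤ ε n

lemma tendsto_growth_div_sq (C A B : ℝ) :
    Tendsto (fun n : ℕ => 64 * (C * (A + 2 * n) ^ (3 / 2 : ℝ) + B) / (n : ℝ) ^ 2) atTop (𝓝 0) := by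
  have h1 : Tendsto (fun n : ℕ => (A + 2 * n) / (n : ℝ)) atTop (𝓝 2) := by
    have : Tendsto (fun n : ℕ => A / (n : ℝ) + 2) atTop (𝓝 (0 + 2)) :=
      (tendsto_const_div_atTop_nhds_zero_nat A).add tendsto_const_nhds
    rw [zero_add] at this
    refine this.congr' ?_
    filter_upwards [eventually_gt_atTop 0] with n hn
    field_simp
  have h2 : Tendsto (fun n : ℕ => ((A + 2 * n) / (n : ℝ)) ^ (3 / 2 : ℝ)) atTop
      (𝓝 (2 ^ (3 / 2 : ℝ))) := h1.rpow_const (by norm_num)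
  have h3 : Tendsto (fun n : ℕ => (n : ℝ) ^ (-(1 / 2) : ℝ)) atTop (𝓝 0) :=
    (tendsto_rpow_neg_atTop (by norm_num)).comp tendsto_natCast_atTop_atTop
  have h4 : Tendsto (fun n : ℕ => B / (n : ℝ) ^ 2) atTop (𝓝 0) :=
    Tendsto.div_atTop tendsto_const_nhds
      ((tendsto_pow_atTop two_ne_zero).comp tendsto_natCast_atTop_atTop)
  have h5 := (((h2.mul h3).const_mul C).add h4).const_mul 64
  simp only [mul_zero, add_zero] at h5
  refine h5.congr' ?_
  have hA : ∀ᶠ n : ℕ in atTop, -A ≤ (n : ℝ) :=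
    tendsto_natCast_atTop_atTop.eventually (eventually_ge_atTop _)
  filter_upwards [eventually_gt_atTop 0, hA] with n hn hAn
  have hn' : (0 : ℝ) < n := by exact_mod_cast hn
  rw [Real.div_rpow (by linarith) hn'.le]
  have e : (n : ℝ) ^ 2 = (n : ℝ) ^ (3 / 2 : ℝ) * (n : ℝ) ^ (1 / 2 : ℝ) := by
    rw [← Real.rpow_add hn', ← Real.rpow_natCast]; norm_num
  rw [Real.rpow_neg hn'.le, e]
  have := Real.rpow_pos_of_pos hn' (3 / 2)
  have := Real.rpow_pos_of_pos hn' (1 / 2)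
  field_simp

theorem nonempty_realZeroFactorization {X : ℂ → ℂ} (hX : Differentiable ℂ X)
    (hreal : ∀ z, X z = 0 → z.im = 0) (heven : ∀ z, X (-z) = X z) {c : ℝ} (hc : X (c * I) ≠ 0)
    {C : ℝ} (hC : 0 ≤ C) (hgrowth : ∀ z, ‖X z‖ ≤ Real.exp (C * (1 + ‖z‖) ^ (3 / 2 : ℝ))) :
    Nonempty (RealZeroFactorization X) := by
  classical
  set b : ℂ := c * I with hb
  choose T hT using fun n : ℕ => exists_finset_zeros_closedBall hX hc b (n : ℝ)
  choose g hg hgne hfac using fun n : ℕ => exists_entire_prod_mul hX hc (T n)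
  set B : ℝ := |Real.log ‖X b‖| + 1
  set M : ℕ → ℝ := fun n => C * ((1 + ‖b‖) + 2 * n) ^ (3 / 2 : ℝ) + B
  have hMpos : ∀ n, 0 < M n := fun n => by positivity
  have hmemS : ∀ n (ρ : ℝ), ρ ∈ (T n).image re ↔ (ρ : ℂ) ∈ T n := by
    intro n ρ
    rw [Finset.mem_image]
    constructor
    · rintro ⟨z, hz, rfl⟩
      have : (z.re : ℂ) = z := by
        apply Complex.ext <;> simp [hreal z ((hT n z).1 hz).2]
      rwa [this]
    · exact fun h => ⟨ρ, h, by simp⟩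
  refine ⟨⟨fun n => (T n).image re, g, fun n => 64 * M n / (n : ℝ) ^ 2,
    tendsto_growth_div_sq C _ B, ?_, ?_, hg, ?_, ?_⟩⟩
  · intro n ρ hρ
    rw [hmemS, hT] at hρ ⊢
    refine ⟨?_, by rw [ofReal_neg, heven]; exact hρ.2⟩
    have : ‖((-ρ : ℝ) : ℂ) - b‖ = ‖(ρ : ℂ) - b‖ := by
      rw [← sq_eq_sq₀ (norm_nonneg _) (norm_nonneg _), Complex.sq_norm, Complex.sq_norm,
        normSq_apply, normSq_apply]
      simp [hb]
    rw [this]; exact hρ.1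
  · intro ρ hρ
    filter_upwards [tendsto_natCast_atTop_atTop.eventually (eventually_ge_atTop ‖(ρ : ℂ) - b‖)]
      with n hn
    rw [hmemS, hT]
    exact ⟨hn, hρ⟩
  · intro n z
    rw [hfac n z]
    congr 1
    refine Finset.prod_nbij' re ofReal (fun ρ hρ => Finset.mem_image_of_mem _ hρ)
      (fun ρ hρ => (hmemS n ρ).1 hρ) (fun ρ hρ => ?_) (fun ρ hρ => by simp) (fun ρ hρ => ?_)
    all_goals
      have : (ρ.re : ℂ) = ρ := by
        apply Complex.ext <;> simp [hreal ρ ((hT n ρ).1 hρ).2]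
      rw [this]
  · intro r
    filter_upwards [tendsto_natCast_atTop_atTop.eventually
      (eventually_ge_atTop (4 * (|r| + ‖b‖) + 1))]
      with n hn z hz
    have hrn := le_abs_self r
    have hr0 := abs_nonneg r
    have hb0 := norm_nonneg b
    have hn0 : (0 : ℝ) < n := by linarith
    have hne : ∀ w, ‖w - b‖ < n → g n w ≠ 0 := by
      intro w hw h0
      have hXw : X w = 0 := by rw [hfac n w, h0, mul_zero]
      exact hgne n w ((hT n w).2 ⟨hw.le, hXw⟩) h0
    have hzb : ‖z - b‖ ≤ n / 4 := (norm_sub_le _ _).trans (by linarith)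
    refine ⟨hne z (by linarith), norm_deriv_logDeriv_le (hg n) hn0 (hMpos n) hne
      (fun w hw => ?_) hzb⟩
    refine norm_le_of_prod_factor (hg n) hc hn0 (fun ρ hρ => ((hT n ρ).1 hρ).1) (hfac n)
      (fun v hv => (hgrowth v).trans ?_) hw
    have hXb : 0 < ‖X b‖ := norm_pos_iff.2 hc
    conv_rhs => rw [← Real.exp_log hXb, ← Real.exp_add]
    have hv' : ‖v‖ ≤ ‖b‖ + 2 * n := by
      have := norm_add_le (v - b) b
      rw [sub_add_cancel] at this
      linarith
    have h1 : C * (1 + ‖v‖) ^ (3 / 2 : ℝ) ≤ C * ((1 + ‖b‖) + 2 * n) ^ (3 / 2 : ℝ) := by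
      gcongr ?_ * ?_ ^ _
      linarith
    have h2 := neg_abs_le (Real.log ‖X b‖)
    refine Real.exp_le_exp.2 ?_
    simp only [M, B]
    linarith

/-! ### Consequences of the factorization -/

lemma inv_sq_sub_add_inv_sq_add_ge {ρ γ : ℝ} (h1 : γ - ρ ≠ 0) (h2 : γ + ρ ≠ 0) :
    1 / (ρ ^ 2 + γ ^ 2) ≤ (1 / (γ - ρ) ^ 2 + 1 / (γ + ρ) ^ 2) / 2 := by
  have h3 : 0 < (γ - ρ) ^ 2 := by positivity
  have h4 : 0 < (γ + ρ) ^ 2 := by positivity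
  have h5 : 0 < ρ ^ 2 + γ ^ 2 := by nlinarith
  rw [div_add_div _ _ h3.ne' h4.ne', div_div, div_le_div_iff₀ h5 (by positivity)]
  nlinarith [sq_nonneg (ρ * γ)]

lemma sum_inv_sq_sub_ge {S : Finset ℝ} {m : ℝ → ℝ} (hm : ∀ ρ, 0 ≤ m ρ)
    (hmneg : ∀ ρ, m (-ρ) = m ρ) (hS : ∀ ρ ∈ S, -ρ ∈ S) {γ₁ γ₂ : ℝ} (h₁ : 0 < γ₁) (h₂ : 0 < γ₂)
    (hne : γ₁ ≠ γ₂) (hγ₁ : γ₁ ∈ S) (hγ₂ : γ₂ ∈ S) (hm₁ : m γ₁ = 1) (hm₂ : m γ₂ = 1) :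
    1 / (γ₁ - γ₂) ^ 2 + ∑ ρ ∈ S, m ρ / (γ₁ ^ 2 + ρ ^ 2) - 1 / γ₁ ^ 2 - 2 / (γ₁ ^ 2 + γ₂ ^ 2)
      ≤ ∑ ρ ∈ S, m ρ / (γ₁ - ρ) ^ 2 := by
  have hsymm : ∑ ρ ∈ S, m ρ / (γ₁ - ρ) ^ 2 = ∑ ρ ∈ S, m ρ / (γ₁ + ρ) ^ 2 := by
    refine Finset.sum_nbij' (fun ρ => -ρ) (fun ρ => -ρ) hS hS (by simp) (by simp) ?_
    intro ρ _
    rw [hmneg]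
    ring
  have hhalf : ∑ ρ ∈ S, m ρ / (γ₁ - ρ) ^ 2 =
      ∑ ρ ∈ S, (m ρ / (γ₁ - ρ) ^ 2 + m ρ / (γ₁ + ρ) ^ 2) / 2 := by
    rw [← Finset.sum_div, Finset.sum_add_distrib, ← hsymm]
    ring
  set A : ℝ := -(1 / (2 * γ₁ ^ 2)) with hA
  set B : ℝ := 1 / (2 * (γ₁ - γ₂) ^ 2) - 1 / (γ₁ ^ 2 + γ₂ ^ 2) with hB
  have key : ∀ ρ ∈ S, m ρ / (γ₁ ^ 2 + ρ ^ 2) +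
      (((if ρ = γ₁ then A else 0) + (if ρ = -γ₁ then A else 0)) +
      ((if ρ = γ₂ then B else 0) + (if ρ = -γ₂ then B else 0))) ≤
      (m ρ / (γ₁ - ρ) ^ 2 + m ρ / (γ₁ + ρ) ^ 2) / 2 := by
    intro ρ _
    have hn1 : γ₁ ≠ -γ₁ := by linarith
    have hn2 : γ₁ ≠ -γ₂ := by linarith
    have hn3 : γ₂ ≠ -γ₁ := by linarith
    have hn4 : γ₂ ≠ -γ₂ := by linarith
    have hd : γ₁ - γ₂ ≠ 0 := sub_ne_zero.2 hne
    have hs : γ₁ + γ₂ ≠ 0 := by linarith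
    have e1 : 1 / (γ₁ ^ 2 + γ₁ ^ 2) + A ≤ 0 := by rw [hA, ← two_mul]; simp
    have e2 : 1 / (γ₁ ^ 2 + γ₂ ^ 2) + B ≤ (1 / (γ₁ - γ₂) ^ 2 + 1 / (γ₁ + γ₂) ^ 2) / 2 := by
      have : 0 ≤ 1 / (γ₁ + γ₂) ^ 2 := by positivity
      have h : 1 / (2 * (γ₁ - γ₂) ^ 2) = 1 / (γ₁ - γ₂) ^ 2 / 2 := by rw [div_div, mul_comm]
      rw [hB, h]
      linarith
    by_cases c1 : ρ = γ₁
    · subst c1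
      simp only [hn1, hne, hn2, if_true, if_false, hm₁]
      refine le_trans (by linarith) (show (0 : ℝ) ≤ _ by positivity)
    by_cases c2 : ρ = -γ₁
    · subst c2
      simp only [c1, neg_inj, hne, hn3.symm, if_true, if_false, hmneg, hm₁, neg_sq]
      refine le_trans (by linarith) (show (0 : ℝ) ≤ _ by positivity)
    by_cases c3 : ρ = γ₂
    · subst c3
      simp only [c1, c2, hn4, if_true, if_false, hm₂]
      linarith
    by_cases c4 : ρ = -γ₂
    · subst c4
      simp only [c1, c2, c3, if_true, if_false, hmneg, hm₂, neg_sq, sub_neg_eq_add,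
        ← sub_eq_add_neg]
      linarith
    simp only [c1, c2, c3, c4, if_false, add_zero]
    have h := mul_le_mul_of_nonneg_left (inv_sq_sub_add_inv_sq_add_ge (ρ := ρ) (γ := γ₁)
      (sub_ne_zero.2 (Ne.symm c1)) (fun h => c2 (by linarith))) (hm ρ)
    calc m ρ / (γ₁ ^ 2 + ρ ^ 2) = m ρ * (1 / (ρ ^ 2 + γ₁ ^ 2)) := by rw [add_comm]; ring
      _ ≤ _ := h
      _ = _ := by ring
  have h := Finset.sum_le_sum key
  rw [← hhalf] at h
  simp only [Finset.sum_add_distrib, Finset.sum_ite_eq', hγ₁, hγ₂, hS γ₁ hγ₁, hS γ₂ hγ₂,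
    if_true] at h
  refine le_trans (le_of_eq ?_) h
  rw [hA, hB]
  field_simp
  ring

lemma analyticOrderNatAt_neg {X : ℂ → ℂ} (heven : ∀ z, X (-z) = X z)
    (z : ℂ) : analyticOrderNatAt X (-z) = analyticOrderNatAt X z := by
  have h := analyticOrderAt_comp_of_deriv_ne_zero (f := X) (g := fun w : ℂ => -w) (z₀ := z)
    (by fun_prop) (by simp)
  have h2 : X ∘ (fun w : ℂ => -w) = X := funext heven
  rw [h2] at h
  simp only [analyticOrderNatAt, ← h]

namespace RealZeroFactorization

variable {X : ℂ → ℂ}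

lemma logDeriv_eq (F : RealZeroFactorization X) (n : ℕ) {z : ℂ} (hz : ∀ ρ ∈ F.S n, z - ρ ≠ 0)
    (hg : F.g n z ≠ 0) :
    logDeriv X z = ∑ ρ ∈ F.S n, (analyticOrderNatAt X ρ : ℂ) / (z - ρ) + logDeriv (F.g n) z := by
  have h1 : X = fun z : ℂ => (∏ ρ ∈ F.S n, (z - ρ) ^ analyticOrderNatAt X ρ) * F.g n z :=
    funext (F.eq_prod_mul n)
  conv_lhs => rw [h1]
  rw [logDeriv_mul z (Finset.prod_ne_zero_iff.2 fun ρ hρ => pow_ne_zero _ (hz ρ hρ)) hg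
    (by fun_prop) (F.differentiable_g n z), logDeriv_prod]
  · congr 1
    refine Finset.sum_congr rfl fun ρ hρ => ?_
    rw [logDeriv_fun_pow (by fun_prop), logDeriv_apply]
    simp [div_eq_mul_inv]
  · intro ρ hρ
    exact pow_ne_zero _ (hz ρ hρ)
  · intro ρ hρ
    fun_prop

/-- The sums `∑ m(ρ) a / (a² + ρ²)` over the zeros compute the logarithmic derivative on the
imaginary axis. -/
lemma tendsto_sum (F : RealZeroFactorization X) (hX : Differentiable ℂ X)
    (heven : ∀ z, X (-z) = X z) {a : ℝ} (ha : 0 < a) :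
    Tendsto (fun n => ∑ ρ ∈ F.S n, (analyticOrderNatAt X ρ : ℝ) / (a ^ 2 + ρ ^ 2)) atTop
      (𝓝 ((logDeriv X (-(a * I))).im / a)) := by
  have hodd : logDeriv X (a * I) = -logDeriv X (-(a * I)) := by
    have h2 : X ∘ (fun w : ℂ => -w) = X := funext heven
    have h := logDeriv_comp (f := X) (g := fun w : ℂ => -w) (x := a * I) (hX _) (by fun_prop)
    rw [h2] at h
    simpa using h
  have hne : ∀ ρ : ℝ, (a * I - ρ : ℂ) ≠ 0 := fun ρ h => by
    have := congrArg Complex.im h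
    simp at this
    exact ha.ne' this
  have hne2 : ∀ ρ : ℝ, (-(a * I) - ρ : ℂ) ≠ 0 := fun ρ h => by
    have := congrArg Complex.im h
    simp at this
    exact ha.ne' this
  have him : ∀ ρ : ℝ, ((analyticOrderNatAt X ρ : ℂ) / (-(a * I) - ρ)).im =
      analyticOrderNatAt X ρ * a / (a ^ 2 + ρ ^ 2) := fun ρ => by
    rw [Complex.div_im]
    simp [Complex.normSq_apply]
    ring
  have him2 : ∀ ρ : ℝ, ((analyticOrderNatAt X ρ : ℂ) / (a * I - ρ)).im =
      -(analyticOrderNatAt X ρ * a / (a ^ 2 + ρ ^ 2)) := fun ρ => by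
    rw [Complex.div_im]
    simp [Complex.normSq_apply]
    ring
  rw [tendsto_iff_norm_sub_tendsto_zero]
  have hε : Tendsto (fun n => F.ε n) atTop (𝓝 0) := F.tendsto_ε
  refine squeeze_zero' (Eventually.of_forall fun n => norm_nonneg _) ?_ hε
  filter_upwards [F.eventually_bound a] with n hn
  have hz1 : ‖(a * I : ℂ)‖ ≤ a := by simp [abs_of_pos ha]
  have hz2 : ‖(-(a * I) : ℂ)‖ ≤ a := by simp [abs_of_pos ha]
  have e1 := F.logDeriv_eq n (fun ρ _ => hne ρ) (hn _ hz1).1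
  have e2 := F.logDeriv_eq n (fun ρ _ => hne2 ρ) (hn _ hz2).1
  have i1 := congrArg Complex.im e1
  have i2 := congrArg Complex.im e2
  rw [hodd] at i1
  simp only [Complex.add_im, Complex.im_sum, him, him2, Complex.neg_im, Finset.sum_neg_distrib]
    at i1 i2
  have hd : ‖logDeriv (F.g n) (a * I) - logDeriv (F.g n) (-(a * I))‖ ≤
      F.ε n * ‖(a * I : ℂ) - -(a * I)‖ := by
    refine Convex.norm_image_sub_le_of_norm_deriv_le (s := Metric.closedBall 0 a) ?_ ?_
      (convex_closedBall _ _) (by simpa using hz2) (by simpa using hz1)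
    · intro w hw
      have hA := (F.differentiable_g n).analyticAt w
      exact hA.deriv.differentiableAt.div hA.differentiableAt (hn w (by simpa using hw)).1
    · intro w hw
      exact (hn w (by simpa using hw)).2
  have hd2 : ‖(a * I : ℂ) - -(a * I)‖ = 2 * a := by
    rw [sub_neg_eq_add, ← two_mul]
    simp [abs_of_pos ha]
  have hd3 := (Complex.abs_im_le_norm _).trans hd
  rw [hd2, Complex.sub_im] at hd3
  have hs : ∑ ρ ∈ F.S n, (analyticOrderNatAt X ρ : ℝ) / (a ^ 2 + ρ ^ 2) =
      (∑ ρ ∈ F.S n, (analyticOrderNatAt X ρ : ℝ) * a / (a ^ 2 + ρ ^ 2)) / a := by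
    rw [Finset.sum_div]
    refine Finset.sum_congr rfl fun ρ _ => ?_
    field_simp
  rw [hs, ← sub_div, Real.norm_eq_abs, abs_div, abs_of_pos ha, div_le_iff₀ ha]
  rw [abs_le] at hd3 ⊢
  constructor <;> linarith

lemma simple_order {W : ℂ → ℂ} (hW : Differentiable ℂ W) {γ : ℝ} (hWγ : W γ ≠ 0)
    (hXW : ∀ z, X z = (z - γ) * W z) : analyticOrderNatAt X γ = 1 := by
  have hX : Differentiable ℂ X := by
    rw [show X = fun z => (z - γ) * W z from funext hXW]
    fun_prop
  have : analyticOrderAt X γ = 1 := by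
    refine (hX.analyticAt _).analyticOrderAt_eq_natCast (n := 1) |>.2
      ⟨W, hW.analyticAt _, hWγ, Eventually.of_forall fun z => ?_⟩
    simp [hXW z]
  simp [analyticOrderNatAt, this]

lemma tendsto_sum_simple (F : RealZeroFactorization X) {W : ℂ → ℂ} (hW : Differentiable ℂ W)
    {γ : ℝ} (hWγ : W γ ≠ 0) (hXW : ∀ z, X z = (z - γ) * W z) :
    Tendsto (fun n => ∑ ρ ∈ F.S n, (analyticOrderNatAt X ρ : ℝ) / (γ - ρ) ^ 2) atTop
      (𝓝 (-(deriv (logDeriv W) γ)).re) := by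
  have hord := simple_order hW hWγ hXW
  rw [tendsto_iff_norm_sub_tendsto_zero]
  refine squeeze_zero' (Eventually.of_forall fun n => norm_nonneg _) ?_ F.tendsto_ε
  filter_upwards [F.eventually_bound |γ|, F.eventually_mem γ (by simp [hXW])] with n hn hmem
  have hγn : ‖(γ : ℂ)‖ ≤ |γ| := by simp
  have hWeq : ∀ z : ℂ, W z =
      (∏ ρ ∈ (F.S n).erase γ, (z - ρ) ^ analyticOrderNatAt X ρ) * F.g n z := by
    have hc1 : Continuous W := hW.continuous
    have hc2 : Continuous fun z : ℂ =>
        (∏ ρ ∈ (F.S n).erase γ, (z - ρ) ^ analyticOrderNatAt X ρ) * F.g n z :=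
      (by fun_prop : Continuous fun z : ℂ =>
        (∏ ρ ∈ (F.S n).erase γ, (z - ρ) ^ analyticOrderNatAt X ρ)).mul
        (F.differentiable_g n).continuous
    refine congrFun (hc1.ext_on (dense_compl_singleton (γ : ℂ)) hc2 fun z hz => ?_)
    have h := F.eq_prod_mul n z
    rw [hXW, ← Finset.mul_prod_erase _ _ hmem, hord, pow_one, mul_assoc] at h
    exact mul_left_cancel₀ (sub_ne_zero.2 hz) h
  have hld : logDeriv W =ᶠ[𝓝 (γ : ℂ)] fun z : ℂ =>
      ∑ ρ ∈ (F.S n).erase γ, (analyticOrderNatAt X ρ : ℂ) / (z - ρ) + logDeriv (F.g n) z := by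
    have ev1 : ∀ᶠ z : ℂ in 𝓝 (γ : ℂ), ∀ ρ ∈ (F.S n).erase γ, z - ρ ≠ 0 := by
      rw [Finset.eventually_all]
      intro ρ hρ
      have : (γ : ℂ) ≠ ρ := fun h => (Finset.mem_erase.1 hρ).1 (by exact_mod_cast h.symm)
      filter_upwards [isOpen_ne.mem_nhds this] with z hz using sub_ne_zero.2 hz
    have ev2 : ∀ᶠ z : ℂ in 𝓝 (γ : ℂ), F.g n z ≠ 0 :=
      (F.differentiable_g n).continuous.continuousAt.eventually_ne (hn _ hγn).1
    filter_upwards [ev1, ev2] with z hz hg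
    have h1 : W = fun z : ℂ =>
        (∏ ρ ∈ (F.S n).erase γ, (z - ρ) ^ analyticOrderNatAt X ρ) * F.g n z :=
      funext hWeq
    conv_lhs => rw [h1]
    rw [logDeriv_mul z (Finset.prod_ne_zero_iff.2 fun ρ hρ => pow_ne_zero _ (hz ρ hρ)) hg
      (by fun_prop) (F.differentiable_g n z), logDeriv_prod]
    · congr 1
      refine Finset.sum_congr rfl fun ρ hρ => ?_
      rw [logDeriv_fun_pow (by fun_prop), logDeriv_apply]
      simp [div_eq_mul_inv]
    · intro ρ hρ
      exact pow_ne_zero _ (hz ρ hρ)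
    · intro ρ hρ
      fun_prop
  have hderiv : deriv (logDeriv W) γ =
      ∑ ρ ∈ (F.S n).erase γ, -((analyticOrderNatAt X ρ : ℂ) / (γ - ρ) ^ 2) +
        deriv (logDeriv (F.g n)) γ := by
    rw [hld.deriv_eq]
    have hA := (F.differentiable_g n).analyticAt (γ : ℂ)
    have hg' : HasDerivAt (logDeriv (F.g n)) (deriv (logDeriv (F.g n)) γ) γ :=
      (hA.deriv.differentiableAt.div hA.differentiableAt (hn _ hγn).1).hasDerivAt
    refine ((HasDerivAt.fun_sum fun ρ hρ => ?_).add hg').deriv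
    have hne : (γ : ℂ) - ρ ≠ 0 := sub_ne_zero.2 fun h =>
      (Finset.mem_erase.1 hρ).1 (by exact_mod_cast h.symm)
    have := (hasDerivAt_const (γ : ℂ) (analyticOrderNatAt X ρ : ℂ)).fun_div
      ((hasDerivAt_id (γ : ℂ)).sub_const (ρ : ℂ)) hne
    refine this.congr_deriv ?_
    simp
    ring
  have hsum : ∑ ρ ∈ F.S n, (analyticOrderNatAt X ρ : ℝ) / (γ - ρ) ^ 2 =
      -(∑ ρ ∈ (F.S n).erase γ, -((analyticOrderNatAt X ρ : ℂ) / (γ - ρ) ^ 2)).re := by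
    rw [← Finset.add_sum_erase _ _ hmem, Complex.re_sum, ← Finset.sum_neg_distrib]
    simp only [sub_self, ne_eq, OfNat.ofNat_ne_zero, not_false_eq_true, zero_pow, div_zero,
      zero_add, Complex.neg_re, neg_neg]
    refine Finset.sum_congr rfl fun ρ _ => ?_
    norm_cast
  rw [hsum, hderiv, neg_add, Complex.add_re, Complex.neg_re, sub_add_cancel_left, Complex.neg_re,
    neg_neg, Real.norm_eq_abs]
  exact (Complex.abs_re_le_norm _).trans (hn _ hγn).2

/-- Lower bound for the sum over the other zeros at a simple zero. -/
lemma simple_zero_ge (F : RealZeroFactorization X) (heven : ∀ z, X (-z) = X z)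
    {γ₁ γ₂ : ℝ} (h₁ : 0 < γ₁) (h₂ : 0 < γ₂) (hne : γ₁ ≠ γ₂) {W₁ W₂ : ℂ → ℂ}
    (hW₁ : Differentiable ℂ W₁) (hWγ₁ : W₁ γ₁ ≠ 0) (hXW₁ : ∀ z, X z = (z - γ₁) * W₁ z)
    (hW₂ : Differentiable ℂ W₂) (hWγ₂ : W₂ γ₂ ≠ 0) (hXW₂ : ∀ z, X z = (z - γ₂) * W₂ z) :
    1 / (γ₁ - γ₂) ^ 2 + (logDeriv X (-(γ₁ * I))).im / γ₁ - 1 / γ₁ ^ 2 - 2 / (γ₁ ^ 2 + γ₂ ^ 2)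
      ≤ (-(deriv (logDeriv W₁) γ₁)).re := by
  have hX : Differentiable ℂ X := by
    rw [show X = fun z => (z - γ₁) * W₁ z from funext hXW₁]
    fun_prop
  refine le_of_tendsto_of_tendsto
    (((F.tendsto_sum hX heven h₁).const_add _).sub_const _ |>.sub_const _)
    (F.tendsto_sum_simple hW₁ hWγ₁ hXW₁) ?_
  filter_upwards [F.eventually_mem γ₁ (by simp [hXW₁]), F.eventually_mem γ₂ (by simp [hXW₂])]
    with n hm1 hm2
  refine sum_inv_sq_sub_ge (m := fun ρ : ℝ => (analyticOrderNatAt X ρ : ℝ))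
    (fun ρ => Nat.cast_nonneg _) (fun ρ => ?_) (F.neg_mem n) h₁ h₂ hne hm1 hm2 ?_ ?_
  · simp [analyticOrderNatAt_neg heven]
  · simp [simple_order hW₁ hWγ₁ hXW₁]
  · simp [simple_order hW₂ hWγ₂ hXW₂]

/-- A positive zero contributes to the difference of two zero sums. -/
lemma zero_contribution_le (F : RealZeroFactorization X) (hX : Differentiable ℂ X)
    (heven : ∀ z, X (-z) = X z) {b : ℂ} (hb : X b ≠ 0) {γ : ℝ} (hγ : 0 < γ) (hXγ : X γ = 0)
    {a₀ a₁ : ℝ} (ha₀ : 0 < a₀) (ha : a₀ ≤ a₁) :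
    2 * (1 / (a₀ ^ 2 + γ ^ 2) - 1 / (a₁ ^ 2 + γ ^ 2)) ≤
      (logDeriv X (-(a₀ * I))).im / a₀ - (logDeriv X (-(a₁ * I))).im / a₁ := by
  refine ge_of_tendsto ((F.tendsto_sum hX heven ha₀).sub
    (F.tendsto_sum hX heven (ha₀.trans_le ha))) ?_
  filter_upwards [F.eventually_mem γ hXγ] with n hn
  have hmono : ∀ ρ : ℝ, 0 ≤ 1 / (a₀ ^ 2 + ρ ^ 2) - 1 / (a₁ ^ 2 + ρ ^ 2) := fun ρ => by
    rw [sub_nonneg]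
    gcongr
  have hm : ∀ ρ : ℝ, X ρ = 0 → (1 : ℝ) ≤ analyticOrderNatAt X ρ := fun ρ hρ => by
    have h1 : analyticOrderAt X ρ ≠ 0 := fun h =>
      ((hX.analyticAt _).analyticOrderAt_eq_zero.1 h) hρ
    have h2 := analyticOrderAt_ne_top_of_entire hX hb ρ
    have h3 : analyticOrderNatAt X ρ ≠ 0 := by
      rw [analyticOrderNatAt, ne_eq, ENat.toNat_eq_zero]
      tauto
    exact_mod_cast Nat.one_le_iff_ne_zero.2 h3
  have hneg : X ((-γ : ℝ) : ℂ) = 0 := by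
    rw [Complex.ofReal_neg, heven, hXγ]
  rw [← Finset.sum_sub_distrib]
  have hsub : ({γ, -γ} : Finset ℝ) ⊆ F.S n := by
    intro x hx
    rcases Finset.mem_insert.1 hx with rfl | hx
    · exact hn
    · rw [Finset.mem_singleton.1 hx]
      exact F.neg_mem n _ hn
  have hterm : ∀ ρ : ℝ, (analyticOrderNatAt X ρ : ℝ) / (a₀ ^ 2 + ρ ^ 2) -
      analyticOrderNatAt X ρ / (a₁ ^ 2 + ρ ^ 2) =
      analyticOrderNatAt X ρ * (1 / (a₀ ^ 2 + ρ ^ 2) - 1 / (a₁ ^ 2 + ρ ^ 2)) := fun ρ => by ring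
  simp only [hterm]
  refine le_trans ?_ (Finset.sum_le_sum_of_subset_of_nonneg hsub fun ρ _ _ =>
    mul_nonneg (Nat.cast_nonneg _) (hmono ρ))
  rw [Finset.sum_pair (by linarith)]
  have h1 := mul_le_mul_of_nonneg_right (hm γ hXγ) (hmono γ)
  have h2 := mul_le_mul_of_nonneg_right (hm (-γ) hneg) (hmono (-γ))
  rw [neg_sq] at h2 ⊢
  linarith

end RealZeroFactorization

/-! ### Growth of the completed zeta function -/

lemma norm_Gamma_le {s : ℂ} (hs : 0 < s.re) : ‖Gamma s‖ ≤ Real.Gamma s.re := by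
  rw [Gamma_eq_integral hs, Real.Gamma_eq_integral hs, GammaIntegral]
  refine (MeasureTheory.norm_integral_le_integral_norm _).trans (le_of_eq ?_)
  refine MeasureTheory.setIntegral_congr_fun measurableSet_Ioi fun x hx => ?_
  simp only [norm_mul, norm_real, Real.norm_eq_abs, abs_of_pos (Real.exp_pos _)]
  rw [norm_cpow_eq_rpow_re_of_pos hx]
  simp

lemma Gamma_le_exp {x : ℝ} (hx : 2 ≤ x) : Real.Gamma x ≤ Real.exp (2 * (1 + x) ^ (3 / 2 : ℝ)) := by
  set n := ⌈x⌉₊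
  have hxn : x ≤ n := Nat.le_ceil x
  have hnx : (n : ℝ) ≤ 1 + x := by have := Nat.ceil_lt_add_one (by linarith : (0 : ℝ) ≤ x); linarith
  have hn0 : (0 : ℝ) < n := by linarith
  have h1 : Real.Gamma x ≤ Real.Gamma (n + 1) :=
    Real.Gamma_strictMonoOn_Ici.monotoneOn hx (by simp only [Set.mem_Ici]; linarith) (by linarith)
  rw [Real.Gamma_nat_eq_factorial] at h1
  have h2 : (n.factorial : ℝ) ≤ (n : ℝ) ^ n := by exact_mod_cast Nat.factorial_le_pow n
  refine h1.trans (h2.trans ?_)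
  rw [← Real.exp_log (pow_pos hn0 n), Real.log_pow]
  refine Real.exp_le_exp.2 ?_
  have h3 : Real.log n ≤ 2 * (n : ℝ) ^ (1 / 2 : ℝ) := by
    have := Real.log_le_rpow_div hn0.le (ε := 1 / 2) (by norm_num)
    linarith
  calc (n : ℝ) * Real.log n ≤ n * (2 * (n : ℝ) ^ (1 / 2 : ℝ)) := by gcongr
    _ = 2 * (n : ℝ) ^ (3 / 2 : ℝ) := by
        rw [show (3 / 2 : ℝ) = 1 + 1 / 2 by norm_num, Real.rpow_add hn0, Real.rpow_one]
        ring
    _ ≤ _ := by gcongr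

lemma exists_norm_zeta_le : ∃ K : ℝ, 0 ≤ K ∧ ∀ s : ℂ, 2 ≤ s.re → ‖riemannZeta s‖ ≤ K := by
  have hsum : Summable fun n : ℕ => 1 / (n : ℝ) ^ 2 := Real.summable_one_div_nat_pow.2 one_lt_two
  refine ⟨∑' n : ℕ, 1 / (n : ℝ) ^ 2, tsum_nonneg fun n => by positivity, fun s hs => ?_⟩
  rw [zeta_eq_tsum_one_div_nat_cpow (by linarith)]
  refine tsum_of_norm_bounded hsum.hasSum fun n => ?_
  rcases Nat.eq_zero_or_pos n with rfl | hn
  · rw [Nat.cast_zero, zero_cpow (fun h => by rw [h] at hs; norm_num at hs)]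
    simp
  · rw [norm_div, norm_one, norm_natCast_cpow_of_pos hn]
    have : (1 : ℝ) ≤ n := by exact_mod_cast hn
    gcongr
    rw [← Real.rpow_natCast]
    exact Real.rpow_le_rpow_of_exponent_le this (by exact_mod_cast hs)

lemma exists_norm_completedZeta₀_strip_le (A B : ℝ) :
    ∃ M : ℝ, ∀ s : ℂ, A ≤ s.re → s.re ≤ B → ‖completedRiemannZeta₀ s‖ ≤ M := by
  set P := HurwitzZeta.hurwitzEvenFEPair 0
  have hconv : ∀ s : ℂ, MellinConvergent P.f_modif s := fun s =>
    (P.isStrongFEPair_toStrongFEPair.hasMellin s).1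
  set N : ℝ → ℝ → ℝ := fun σ t => ‖(t : ℂ) ^ ((σ : ℂ) - 1) • P.f_modif t‖
  have hN : ∀ σ, MeasureTheory.IntegrableOn (N σ) (Set.Ioi 0) := fun σ => (hconv σ).norm
  have hNeq : ∀ (s : ℂ) (t : ℝ), 0 < t →
      ‖(t : ℂ) ^ (s - 1) • P.f_modif t‖ = t ^ (s.re - 1) * ‖P.f_modif t‖ := fun s t ht => by
    rw [norm_smul, norm_cpow_eq_rpow_re_of_pos ht]
    simp
  refine ⟨(∫ t in Set.Ioi 0, (N (A / 2) t + N (B / 2) t)) / 2, fun s hA hB => ?_⟩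
  rw [completedRiemannZeta₀, HurwitzZeta.completedHurwitzZetaEven₀, norm_div]
  have h2 : ‖(2 : ℂ)‖ = 2 := by simp
  rw [h2]
  gcongr
  refine MeasureTheory.norm_integral_le_of_norm_le ((hN _).add (hN _)) ?_
  refine (MeasureTheory.ae_restrict_iff' measurableSet_Ioi).2 (Eventually.of_forall fun t ht => ?_)
  have ht : 0 < t := ht
  simp only [N]
  rw [hNeq _ t ht, hNeq _ t ht, hNeq _ t ht, ← add_mul]
  gcongr
  have hre : (s / 2).re = s.re / 2 := by simp
  rw [hre, ofReal_re, ofReal_re]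
  rcases le_total 1 t with h | h
  · refine (Real.rpow_le_rpow_of_exponent_le h (by linarith : s.re / 2 - 1 ≤ B / 2 - 1)).trans ?_
    have := Real.rpow_nonneg ht.le (A / 2 - 1)
    linarith
  · refine (Real.rpow_le_rpow_of_exponent_ge ht h (by linarith : A / 2 - 1 ≤ s.re / 2 - 1)).trans ?_
    have := Real.rpow_nonneg ht.le (B / 2 - 1)
    linarith

lemma exists_norm_completedZeta₀_right_le :
    ∃ K : ℝ, 0 ≤ K ∧ ∀ s : ℂ, 4 ≤ s.re →
      ‖completedRiemannZeta₀ s‖ ≤ 2 + K * Real.exp (2 * (1 + ‖s‖) ^ (3 / 2 : ℝ)) := by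
  obtain ⟨K, hK, hζ⟩ := exists_norm_zeta_le
  refine ⟨K, hK, fun s hs => ?_⟩
  have hs0 : s ≠ 0 := fun h => by rw [h] at hs; norm_num at hs
  have hre := re_le_norm s
  have hcomp : completedRiemannZeta₀ s = 1 / s + 1 / (1 - s) + Gammaℝ s * riemannZeta s := by
    rw [riemannZeta_def_of_ne_zero hs0, mul_div_cancel₀ _ (Gammaℝ_ne_zero_of_re_pos (by linarith)),
      completedRiemannZeta_eq]
    ring
  have b1 : ‖1 / s‖ ≤ 1 := by
    rw [norm_div, norm_one, div_le_one (norm_pos_iff.2 hs0)]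
    linarith
  have b2 : ‖1 / (1 - s)‖ ≤ 1 := by
    have h := re_le_norm (s - 1)
    rw [norm_sub_rev, sub_re, one_re] at h
    rw [norm_div, norm_one, div_le_one (by linarith)]
    linarith
  have b3 : ‖Gammaℝ s‖ ≤ Real.exp (2 * (1 + ‖s‖) ^ (3 / 2 : ℝ)) := by
    have e : (s / 2).re = s.re / 2 := by simp
    rw [Gammaℝ_def, norm_mul, norm_cpow_eq_rpow_re_of_pos Real.pi_pos]
    have c1 : Real.pi ^ (-s / 2).re ≤ 1 := by
      refine Real.rpow_le_one_of_one_le_of_nonpos (by linarith [Real.pi_gt_three]) ?_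
      have : (-s / 2).re = -s.re / 2 := by simp
      linarith
    have c2 := norm_Gamma_le (s := s / 2) (by linarith)
    have c3 := Gamma_le_exp (x := (s / 2).re) (by linarith)
    have c4 : Real.exp (2 * (1 + (s / 2).re) ^ (3 / 2 : ℝ)) ≤
        Real.exp (2 * (1 + ‖s‖) ^ (3 / 2 : ℝ)) := by
      gcongr
      · linarith
      · linarith
    calc _ ≤ 1 * ‖Gamma (s / 2)‖ := by gcongr
      _ ≤ _ := by linarith
  rw [hcomp]
  refine (norm_add₃_le).trans ?_
  rw [norm_mul, mul_comm ‖Gammaℝ s‖]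
  have := mul_le_mul (hζ s (by linarith)) b3 (norm_nonneg _) hK
  linarith

lemma exists_norm_completedZeta₀_le :
    ∃ M : ℝ, 0 ≤ M ∧ ∀ s : ℂ,
      ‖completedRiemannZeta₀ s‖ ≤ M * Real.exp (2 * (2 + ‖s‖) ^ (3 / 2 : ℝ)) := by
  obtain ⟨K, hK, hr⟩ := exists_norm_completedZeta₀_right_le
  obtain ⟨M, hM⟩ := exists_norm_completedZeta₀_strip_le (-3) 4
  have hM0 : 0 ≤ M := (norm_nonneg _).trans (hM 0 (by simp) (by simp))
  have hright : ∀ s w : ℂ, 4 ≤ w.re → ‖w‖ ≤ 1 + ‖s‖ →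
      ‖completedRiemannZeta₀ w‖ ≤ (2 + K + M) * Real.exp (2 * (2 + ‖s‖) ^ (3 / 2 : ℝ)) := by
    intro s w hw hws
    refine (hr w hw).trans ?_
    have h1 : Real.exp (2 * (1 + ‖w‖) ^ (3 / 2 : ℝ)) ≤ Real.exp (2 * (2 + ‖s‖) ^ (3 / 2 : ℝ)) :=
      Real.exp_le_exp.2 (mul_le_mul_of_nonneg_left
        (Real.rpow_le_rpow (by positivity) (by linarith) (by norm_num)) (by norm_num))
    have h2 : 1 ≤ Real.exp (2 * (2 + ‖s‖) ^ (3 / 2 : ℝ)) := Real.one_le_exp (by positivity)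
    nlinarith [mul_le_mul_of_nonneg_left h1 hK, mul_le_mul_of_nonneg_left h2 hM0]
  refine ⟨2 + K + M, by linarith, fun s => ?_⟩
  rcases le_total 4 s.re with h | h
  · exact hright s s h (by linarith)
  rcases le_total (-3) s.re with h' | h'
  · have h2 : 1 ≤ Real.exp (2 * (2 + ‖s‖) ^ (3 / 2 : ℝ)) := Real.one_le_exp (by positivity)
    refine (hM s h' h).trans ?_
    nlinarith
  · rw [← completedRiemannZeta₀_one_sub]
    refine hright s (1 - s) ?_ ((norm_sub_le _ _).trans (by simp))
    simp only [sub_re, one_re]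
    linarith

/-! ### The entire function on the critical line -/

/-- Twice Riemann's `Ξ`-function, up to sign: `s (s - 1) Λ(s)` at `s = 1/2 + i z`. -/
noncomputable def xiLine (z : ℂ) : ℂ := 1 - (z ^ 2 + 1 / 4) * completedRiemannZeta₀ (1 / 2 + I * z)

lemma differentiable_xiLine : Differentiable ℂ xiLine := by
  unfold xiLine
  have := differentiable_completedZeta₀
  fun_prop

lemma xiLine_neg (z : ℂ) : xiLine (-z) = xiLine z := by
  unfold xiLine
  rw [neg_sq, ← completedRiemannZeta₀_one_sub]
  congr 3
  ring

lemma xiLine_I_half : xiLine ((1 / 2 : ℝ) * I) = 1 := by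
  unfold xiLine
  rw [mul_pow, I_sq]
  push_cast
  ring

lemma xiLine_eq {z : ℂ} (h0 : 1 / 2 + I * z ≠ 0) (h1 : 1 / 2 + I * z ≠ 1) :
    xiLine z = -(z ^ 2 + 1 / 4) * completedRiemannZeta (1 / 2 + I * z) := by
  have h1' : 1 - (1 / 2 + I * z) ≠ 0 := sub_ne_zero.2 h1.symm
  have hz : z ^ 2 + 1 / 4 = (1 / 2 + I * z) * (1 - (1 / 2 + I * z)) := by
    ring_nf
    rw [I_sq]
    ring
  rw [xiLine, completedRiemannZeta_eq, hz]
  generalize (1 / 2 + I * z : ℂ) = s at h0 h1'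
  field_simp
  ring

lemma exists_norm_xiLine_le :
    ∃ C : ℝ, 0 ≤ C ∧ ∀ z, ‖xiLine z‖ ≤ Real.exp (C * (1 + ‖z‖) ^ (3 / 2 : ℝ)) := by
  obtain ⟨M, hM, hb⟩ := exists_norm_completedZeta₀_le
  refine ⟨2 * 3 ^ (3 / 2 : ℝ) + 3 + M, by positivity, fun z => ?_⟩
  set u := 1 + ‖z‖ with hu
  have hz0 := norm_nonneg z
  have hu1 : 1 ≤ u := by linarith
  set v := u ^ (3 / 2 : ℝ) with hv
  have huv : u ≤ v := by
    conv_lhs => rw [← Real.rpow_one u]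
    exact Real.rpow_le_rpow_of_exponent_le hu1 (by norm_num)
  have hs : ‖(1 / 2 + I * z : ℂ)‖ ≤ u := by
    refine (norm_add_le _ _).trans ?_
    have : ‖(1 / 2 : ℂ)‖ ≤ 1 := by norm_num
    rw [norm_mul, norm_I, one_mul]
    linarith
  have h1 : Real.exp (2 * (2 + ‖(1 / 2 + I * z : ℂ)‖) ^ (3 / 2 : ℝ)) ≤
      Real.exp (2 * 3 ^ (3 / 2 : ℝ) * v) := by
    rw [mul_assoc, hv, ← Real.mul_rpow (by norm_num) (by linarith)]
    gcongr
    linarith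
  have h2 : ‖(z ^ 2 + 1 / 4 : ℂ)‖ ≤ u ^ 2 := by
    refine (norm_add_le _ _).trans ?_
    have : ‖(1 / 4 : ℂ)‖ ≤ 1 := by norm_num
    rw [norm_pow]
    nlinarith
  have h3 : 1 + M * u ^ 2 ≤ Real.exp ((3 + M) * v) := by
    have e1 : 1 + M * u ^ 2 ≤ (1 + M) * u ^ 2 := by nlinarith
    have e2 : 1 + M ≤ Real.exp (M * v) := by
      have := Real.add_one_le_exp (M * v)
      nlinarith
    have e3 : u ≤ Real.exp v := by linarith [Real.add_one_le_exp v]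
    have e4 : u ^ 2 ≤ Real.exp v ^ 2 := by gcongr
    have e5 : Real.exp v ^ 2 ≤ Real.exp (3 * v) := by
      rw [← Real.exp_nat_mul]
      gcongr
      push_cast
      linarith
    rw [add_mul, add_comm, Real.exp_add]
    calc _ ≤ (1 + M) * u ^ 2 := by linarith
      _ ≤ Real.exp (M * v) * Real.exp (3 * v) := by gcongr; linarith
      _ = _ := by ring
  have h4 : 1 ≤ Real.exp (2 * 3 ^ (3 / 2 : ℝ) * v) := Real.one_le_exp (by positivity)
  rw [add_assoc, add_mul, Real.exp_add]
  calc ‖xiLine z‖ ≤ 1 + u ^ 2 * (M * Real.exp (2 * 3 ^ (3 / 2 : ℝ) * v)) := by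
        unfold xiLine
        refine (norm_sub_le _ _).trans ?_
        rw [norm_mul, norm_one]
        gcongr
        exact (hb _).trans (by gcongr)
    _ ≤ Real.exp (2 * 3 ^ (3 / 2 : ℝ) * v) * (1 + M * u ^ 2) := by nlinarith
    _ ≤ _ := by gcongr

lemma xiLine_zero_real (hRH : RiemannHypothesis) {z : ℂ} (hz : xiLine z = 0) : z.im = 0 := by
  have hq : ∀ w : ℂ, w ^ 2 + 1 / 4 = (1 / 2 + I * w) * (1 - (1 / 2 + I * w)) := fun w => by
    ring_nf
    rw [I_sq]
    ring
  set s := 1 / 2 + I * z with hs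
  have h0 : s ≠ 0 := fun h => by
    rw [xiLine, hq, ← hs, h] at hz
    simp at hz
  have h1 : s ≠ 1 := fun h => by
    rw [xiLine, hq, ← hs, h] at hz
    simp at hz
  have h1' : 1 - s ≠ 0 := sub_ne_zero.2 h1.symm
  have hΛ : completedRiemannZeta s = 0 := by
    rw [xiLine_eq h0 h1, hq, ← hs] at hz
    exact (mul_eq_zero.1 hz).resolve_left (neg_ne_zero.2 (mul_ne_zero h0 h1'))
  have hζ : riemannZeta s = 0 := by rw [riemannZeta_def_of_ne_zero h0, hΛ, zero_div]
  have htriv : ¬ ∃ n : ℕ, s = -2 * (n + 1) := by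
    rintro ⟨n, hn⟩
    have hre : 1 < (1 - s).re := by
      rw [hn]
      simp
      positivity
    have hne : 1 - s ≠ 0 := h1'
    rw [← completedRiemannZeta_one_sub] at hΛ
    refine riemannZeta_ne_zero_of_one_lt_re hre ?_
    rw [riemannZeta_def_of_ne_zero hne, hΛ, zero_div]
  have := hRH s hζ htriv h1
  rw [hs] at this
  simpa using this

lemma nonempty_xiLine_factorization (hRH : RiemannHypothesis) :
    Nonempty (RealZeroFactorization xiLine) := by
  obtain ⟨C, hC, hb⟩ := exists_norm_xiLine_le
  exact nonempty_realZeroFactorization differentiable_xiLine (fun z hz => xiLine_zero_real hRH hz)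
    xiLine_neg (c := 1 / 2) (by rw [xiLine_I_half]; exact one_ne_zero) hC hb

/-! ### The digamma function -/

lemma tendsto_iteratedDeriv_of_bounded {f : ℕ → ℂ → ℂ} {F : ℂ → ℂ} {c : ℂ} {R M : ℝ} (hR : 0 < R)
    (hf : ∀ n, DiffContOnCl ℂ (f n) (Metric.ball c R)) (hF : DiffContOnCl ℂ F (Metric.ball c R))
    (hb : ∀ n, ∀ z ∈ Metric.sphere c R, ‖f n z‖ ≤ M)
    (hlim : ∀ z ∈ Metric.sphere c R, Tendsto (fun n => f n z) atTop (𝓝 (F z))) (k : ℕ) :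
    Tendsto (fun n => iteratedDeriv k (f n) c) atTop (𝓝 (iteratedDeriv k F c)) := by
  have hpi : (2 * Real.pi * I / k.factorial : ℂ) ≠ 0 := by
    simp [Nat.factorial_ne_zero]
  have hform : ∀ g : ℂ → ℂ, DiffContOnCl ℂ g (Metric.ball c R) → iteratedDeriv k g c =
      (2 * Real.pi * I / k.factorial : ℂ)⁻¹ • ∮ z in C(c, R), (1 / (z - c) ^ (k + 1)) • g z := by
    intro g hg
    rw [hg.circleIntegral_one_div_sub_center_pow_smul hR k, inv_smul_smul₀ hpi]
  rw [hform F hF]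
  simp only [hform _ (hf _)]
  refine Tendsto.const_smul ?_ _
  have hmem : ∀ θ, circleMap c R θ ∈ Metric.sphere c R := circleMap_mem_sphere c hR.le
  have hnorm : ∀ θ, ‖circleMap c R θ - c‖ = R := fun θ => mem_sphere_iff_norm.1 (hmem θ)
  refine intervalIntegral.tendsto_integral_filter_of_dominated_convergence
    (fun _ => R * (1 / R ^ (k + 1) * M)) ?_ ?_ (by simp) ?_
  · refine Eventually.of_forall fun n => Continuous.aestronglyMeasurable ?_
    have hc : Continuous fun θ => f n (circleMap c R θ) :=
      (hf n).continuousOn_ball.comp_continuous (continuous_circleMap c R)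
        fun θ => Metric.sphere_subset_closedBall (hmem θ)
    have hi : Continuous fun θ => 1 / (circleMap c R θ - c) ^ (k + 1) :=
      continuous_const.div (((continuous_circleMap c R).sub continuous_const).pow _)
        fun θ => pow_ne_zero _ (norm_pos_iff.1 (by rw [hnorm]; exact hR))
    simp only [deriv_circleMap]
    exact ((continuous_circleMap 0 R).mul continuous_const).smul (hi.smul hc)
  · refine Eventually.of_forall fun n => Eventually.of_forall fun θ _ => ?_
    simp only [deriv_circleMap, norm_smul, norm_mul, norm_I, norm_circleMap_zero, abs_of_pos hR,
      norm_div, norm_pow, hnorm, norm_one, mul_one]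
    gcongr
    exact hb n _ (hmem θ)
  · exact Eventually.of_forall fun θ _ => ((hlim _ (hmem θ)).const_smul _).const_smul _

lemma norm_GammaSeq_le {s : ℂ} (hs : 0 < s.re) {n : ℕ} (hn : n ≠ 0) :
    ‖GammaSeq s n‖ ≤ Real.Gamma s.re := by
  have hn' : (0 : ℝ) < n := by exact_mod_cast Nat.pos_of_ne_zero hn
  rw [GammaSeq_eq_approx_Gamma_integral hs hn, Real.Gamma_eq_integral hs,
    intervalIntegral.integral_of_le hn'.le]
  have hint := Real.GammaIntegral_convergent hs
  have hsub : Set.Ioc (0 : ℝ) n ⊆ Set.Ioi 0 := fun x hx => hx.1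
  refine (MeasureTheory.norm_integral_le_of_norm_le (hint.mono_set hsub) ?_).trans
    (MeasureTheory.setIntegral_mono_set hint ?_ hsub.eventuallyLE)
  · refine (MeasureTheory.ae_restrict_iff' measurableSet_Ioc).2
      (Eventually.of_forall fun x hx => ?_)
    have h0 : 0 ≤ 1 - x / n := sub_nonneg.2 ((div_le_one hn').2 hx.2)
    rw [norm_mul, norm_cpow_eq_rpow_re_of_pos hx.1, norm_real, Real.norm_eq_abs,
      abs_of_nonneg (pow_nonneg h0 n)]
    have h1 := Real.rpow_nonneg hx.1.le (s.re - 1)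
    simp only [sub_re, one_re]
    exact mul_le_mul_of_nonneg_right (Real.one_sub_div_pow_le_exp_neg hx.2) h1
  · refine (MeasureTheory.ae_restrict_iff' measurableSet_Ioi).2
      (Eventually.of_forall fun x hx => ?_)
    have h1 := Real.rpow_nonneg (le_of_lt hx) (s.re - 1)
    have h2 := Real.exp_pos (-x)
    exact mul_nonneg h2.le h1

lemma add_natCast_ne_zero {s : ℂ} (hs : 0 < s.re) (j : ℕ) : s + j ≠ 0 := fun h => by
  have := congrArg re h
  simp at this
  have hj : (0 : ℝ) ≤ j := Nat.cast_nonneg j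
  linarith

lemma differentiableAt_GammaSeq {s : ℂ} (hs : 0 < s.re) {n : ℕ} (hn : n ≠ 0) :
    DifferentiableAt ℂ (fun z => GammaSeq z n) s := by
  unfold GammaSeq
  have hn' : (n : ℂ) ≠ 0 := Nat.cast_ne_zero.2 hn
  refine DifferentiableAt.div ?_ (by fun_prop)
    (Finset.prod_ne_zero_iff.2 fun j _ => add_natCast_ne_zero hs j)
  exact (differentiableAt_id.const_cpow (Or.inl hn')).mul_const _

lemma logDeriv_GammaSeq {s : ℂ} (hs : 0 < s.re) {n : ℕ} (hn : n ≠ 0) :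
    logDeriv (fun z => GammaSeq z n) s =
      Real.log n - ∑ j ∈ Finset.range (n + 1), 1 / (s + j) := by
  unfold GammaSeq
  have hn' : (n : ℂ) ≠ 0 := Nat.cast_ne_zero.2 hn
  have hcpow : DifferentiableAt ℂ (fun z : ℂ => (n : ℂ) ^ z) s :=
    differentiableAt_id.const_cpow (Or.inl hn')
  rw [logDeriv_div (f := fun z : ℂ => (n : ℂ) ^ z * n.factorial)
    (g := fun z : ℂ => ∏ j ∈ Finset.range (n + 1), (z + j)) s
    (mul_ne_zero (by simp [cpow_eq_zero_iff, hn'])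
    (Nat.cast_ne_zero.2 n.factorial_ne_zero))
    (Finset.prod_ne_zero_iff.2 fun j _ => add_natCast_ne_zero hs j)
    (hcpow.mul_const _) (by fun_prop), logDeriv_mul_const s _
      (Nat.cast_ne_zero.2 n.factorial_ne_zero), logDeriv_prod]
  · congr 1
    · have hd : deriv (HPow.hPow (n : ℂ)) s = _ :=
        ((hasDerivAt_id s).const_cpow (Or.inl hn')).deriv
      rw [logDeriv_apply, hd, natCast_log]
      have : (n : ℂ) ^ s ≠ 0 := by simp [cpow_eq_zero_iff, hn']
      simp only [id]
      field_simp
    · refine Finset.sum_congr rfl fun j _ => ?_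
      rw [logDeriv_apply]
      simp
  · exact fun j _ => add_natCast_ne_zero hs j
  · exact fun j _ => by fun_prop

lemma tendsto_iteratedDeriv_GammaSeq {s : ℂ} (hs : 0 < s.re) (k : ℕ) :
    Tendsto (fun n : ℕ => iteratedDeriv k (fun z => GammaSeq z (n + 1)) s) atTop
      (𝓝 (iteratedDeriv k Gamma s)) := by
  set R := s.re / 2 with hR
  have hRpos : 0 < R := by linarith
  have hre : ∀ z ∈ Metric.closedBall s R, 0 < z.re := fun z hz => by
    have h1 := abs_re_le_norm (z - s)
    have h2 : ‖z - s‖ ≤ R := by simpa [dist_eq_norm] using hz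
    rw [sub_re] at h1
    have := (abs_le.1 (h1.trans h2)).1
    linarith
  have hΓ : ∀ z ∈ Metric.closedBall s R, DifferentiableAt ℂ Gamma z := fun z hz =>
    differentiableAt_Gamma z fun m h => by
      have := hre z hz
      rw [h] at this
      simp at this
      have hj : (0 : ℝ) ≤ m := Nat.cast_nonneg m
      linarith
  have hcont : ContinuousOn (fun z : ℂ => Real.Gamma z.re) (Metric.closedBall s R) := fun z hz => by
    have h0 := hre z hz
    have : ContinuousAt Real.Gamma z.re := (Real.differentiableAt_Gamma fun m h => by
      have hj : (0 : ℝ) ≤ m := Nat.cast_nonneg m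
      linarith).continuousAt
    exact (this.comp continuous_re.continuousAt).continuousWithinAt
  obtain ⟨M, hM⟩ := (isCompact_closedBall s R).exists_bound_of_continuousOn hcont
  have hdc : ∀ g : ℂ → ℂ, (∀ z ∈ Metric.closedBall s R, DifferentiableAt ℂ g z) →
      DiffContOnCl ℂ g (Metric.ball s R) := fun g hg =>
    DifferentiableOn.diffContOnCl fun z hz =>
      (hg z (Metric.closure_ball_subset_closedBall hz)).differentiableWithinAt
  refine tendsto_iteratedDeriv_of_bounded (M := M) hRpos (fun n => hdc _ fun z hz =>
    differentiableAt_GammaSeq (hre z hz) n.succ_ne_zero) (hdc _ hΓ) (fun n z hz => ?_)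
    (fun z hz => ?_) k
  · have hz' := Metric.sphere_subset_closedBall hz
    exact (norm_GammaSeq_le (hre z hz') n.succ_ne_zero).trans
      ((le_abs_self _).trans (hM z hz'))
  · exact (GammaSeq_tendsto_Gamma z).comp (tendsto_add_atTop_nat 1)

lemma tendsto_digamma {s : ℂ} (hs : 0 < s.re) :
    Tendsto (fun n : ℕ => (Real.log ((n : ℝ) + 1) : ℂ) - ∑ j ∈ Finset.range (n + 2), 1 / (s + j))
      atTop (𝓝 (digamma s)) := by
  have h0 := tendsto_iteratedDeriv_GammaSeq hs 0
  have h1 := tendsto_iteratedDeriv_GammaSeq hs 1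
  simp only [iteratedDeriv_zero, iteratedDeriv_one] at h0 h1
  have hne : Gamma s ≠ 0 := Gamma_ne_zero_of_re_pos hs
  rw [digamma_def, logDeriv_apply]
  refine (h1.div h0 hne).congr fun n => ?_
  have := logDeriv_GammaSeq hs n.succ_ne_zero
  rw [logDeriv_apply] at this
  rw [Pi.div_apply, this]
  push_cast
  rfl

lemma tendsto_deriv_digamma {s : ℂ} (hs : 0 < s.re) :
    Tendsto (fun n : ℕ => ∑ j ∈ Finset.range (n + 2), 1 / (s + j) ^ 2)
      atTop (𝓝 (deriv digamma s)) := by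
  have h0 := tendsto_iteratedDeriv_GammaSeq hs 0
  have h1 := tendsto_iteratedDeriv_GammaSeq hs 1
  have h2 := tendsto_iteratedDeriv_GammaSeq hs 2
  simp only [iteratedDeriv_zero, iteratedDeriv_one] at h0 h1
  simp only [iteratedDeriv_succ, iteratedDeriv_zero] at h2
  have hne : Gamma s ≠ 0 := Gamma_ne_zero_of_re_pos hs
  have hopen : IsOpen {z : ℂ | 0 < z.re} := isOpen_lt continuous_const continuous_re
  have hquot : ∀ g : ℂ → ℂ, (∀ z : ℂ, 0 < z.re → DifferentiableAt ℂ g z) → g s ≠ 0 →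
      deriv (logDeriv g) s = (deriv (deriv g) s * g s - deriv g s * deriv g s) / g s ^ 2 := by
    intro g hg hgs
    have han : AnalyticAt ℂ g s :=
      DifferentiableOn.analyticAt (s := {z : ℂ | 0 < z.re})
        (fun z hz => (hg z hz).differentiableWithinAt) (hopen.mem_nhds hs)
    exact (han.deriv.differentiableAt.hasDerivAt.div han.differentiableAt.hasDerivAt hgs).deriv
  have hΓ : ∀ z : ℂ, 0 < z.re → DifferentiableAt ℂ Gamma z := fun z hz =>
    differentiableAt_Gamma z fun m h => by
      rw [h] at hz
      simp at hz
      have hj : (0 : ℝ) ≤ m := Nat.cast_nonneg m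
      linarith
  rw [digamma_def, hquot Gamma hΓ hne]
  refine (((h2.mul h0).sub (h1.mul h1)).div (h0.pow 2) (pow_ne_zero 2 hne)).congr' ?_
  filter_upwards [h0.eventually_ne hne] with n hn
  have h3 := hquot (fun z => GammaSeq z (n + 1))
    (fun z hz => differentiableAt_GammaSeq hz n.succ_ne_zero) hn
  refine h3.symm.trans ?_
  have h4 : logDeriv (fun z => GammaSeq z (n + 1)) =ᶠ[𝓝 s] fun z =>
      ((Real.log ((n + 1 : ℕ) : ℝ) : ℂ) - ∑ j ∈ Finset.range (n + 1 + 1), 1 / (z + j)) := by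
    filter_upwards [hopen.mem_nhds hs] with z hz using logDeriv_GammaSeq hz n.succ_ne_zero
  rw [h4.deriv_eq]
  have h5 : ∀ j : ℕ, HasDerivAt (fun z : ℂ => 1 / (z + j)) (-(1 / (s + j) ^ 2)) s := fun j => by
    have := ((hasDerivAt_id s).add_const (j : ℂ)).fun_inv (add_natCast_ne_zero hs j)
    simp only [id] at this
    simp only [one_div]
    exact this.congr_deriv (by ring)
  rw [((HasDerivAt.fun_sum fun j _ => h5 j).const_sub _).deriv, Finset.sum_neg_distrib, neg_neg]

lemma one_div_le_log_sub {y : ℝ} (hy : 1 / 2 < y) :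
    1 / y ≤ Real.log (y + 1 / 2) - Real.log (y - 1 / 2) := by
  have h0 : 0 < y - 1 / 2 := by linarith
  have h := Real.le_log_one_add_of_nonneg (x := 1 / (y - 1 / 2)) (by positivity)
  rw [← Real.log_div (by linarith) h0.ne']
  have e1 : (y + 1 / 2) / (y - 1 / 2) = 1 + 1 / (y - 1 / 2) := by
    rw [one_add_div h0.ne']
    congr 1
    ring
  have e2 : 2 * (1 / (y - 1 / 2)) / (1 / (y - 1 / 2) + 2) = 1 / y := by
    have : (2 * y - 1) ≠ 0 := by linarith
    have : y ≠ 0 := by linarith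
    field_simp
    ring
  rwa [e1, ← e2]

lemma log_sub_le_trapezoid {y : ℝ} (hy : 0 < y) :
    Real.log (y + 1) - Real.log y ≤ (1 / y + 1 / (y + 1)) / 2 := by
  rw [← Real.log_div (by linarith) hy.ne']
  have h1 : 1 ≤ (y + 1) / y := by rw [le_div_iff₀ hy]; linarith
  have h := Real.self_le_sinh_iff.2 (Real.log_nonneg h1)
  rw [Real.sinh_eq, Real.exp_neg, Real.exp_log (by linarith)] at h
  refine h.trans (le_of_eq ?_)
  field_simp
  ring

lemma tendsto_digamma_re {x : ℝ} (hx : 0 < x) :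
    Tendsto (fun n : ℕ => Real.log ((n : ℝ) + 1) - ∑ j ∈ Finset.range (n + 2), 1 / (x + j))
      atTop (𝓝 (digamma x).re) := by
  refine ((continuous_re.tendsto _).comp (tendsto_digamma (s := x) (by simpa))).congr fun n => ?_
  simp only [Function.comp_apply, sub_re, ofReal_re, re_sum]
  congr 1
  refine Finset.sum_congr rfl fun j _ => ?_
  norm_cast

lemma tendsto_log_sub_log (a : ℝ) :
    Tendsto (fun n : ℕ => Real.log ((n : ℝ) + 1) - Real.log (n + a)) atTop (𝓝 0) := by
  have h1 : Tendsto (fun n : ℕ => ((n : ℝ) + 1) / (n + a)) atTop (𝓝 1) := by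
    have hn := tendsto_natCast_atTop_atTop (R := ℝ)
    have h : Tendsto (fun n : ℕ => 1 + (1 - a) / ((n : ℝ) + a)) atTop (𝓝 (1 + 0)) :=
      ((hn.atTop_add tendsto_const_nhds).const_div_atTop (1 - a)).const_add 1
    rw [add_zero] at h
    refine h.congr' ?_
    filter_upwards [hn.eventually_gt_atTop (-a)] with n hn
    have : (n : ℝ) + a ≠ 0 := by linarith
    field_simp
    ring
  have h2 := h1.log one_ne_zero
  rw [Real.log_one] at h2
  refine h2.congr' ?_
  filter_upwards [(tendsto_natCast_atTop_atTop (R := ℝ)).eventually_gt_atTop (-a)] with n hn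
  rw [Real.log_div (by positivity) (by linarith)]

lemma log_sub_half_le_digamma {x : ℝ} (hx : 1 / 2 < x) :
    Real.log (x - 1 / 2) ≤ (digamma x).re := by
  have h := (tendsto_log_sub_log (x + 3 / 2)).add_const (Real.log (x - 1 / 2))
  rw [zero_add] at h
  refine le_of_tendsto_of_tendsto' h (tendsto_digamma_re (by linarith)) fun n => ?_
  have hsum : ∑ j ∈ Finset.range (n + 2), 1 / (x + j) ≤
      Real.log (x - 1 / 2 + (n + 2 : ℕ)) - Real.log (x - 1 / 2) := by
    have := Finset.sum_range_sub (fun j : ℕ => Real.log (x - 1 / 2 + j)) (n + 2)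
    rw [Nat.cast_zero, add_zero] at this
    rw [← this]
    refine Finset.sum_le_sum fun j _ => ?_
    have hj : (0 : ℝ) ≤ j := Nat.cast_nonneg j
    refine (one_div_le_log_sub (by linarith)).trans (le_of_eq ?_)
    push_cast
    ring_nf
  have e : x - 1 / 2 + (n + 2 : ℕ) = n + (x + 3 / 2) := by push_cast; ring
  rw [e] at hsum
  linarith

lemma digamma_le_log_sub {x : ℝ} (hx : 0 < x) :
    (digamma x).re ≤ Real.log x - 1 / (2 * x) := by
  have h := (tendsto_log_sub_log (x + 1)).add_const (Real.log x - 1 / (2 * x))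
  rw [zero_add] at h
  refine le_of_tendsto_of_tendsto' (tendsto_digamma_re hx) h fun n => ?_
  have hsum : ∀ N : ℕ, Real.log (x + N) - Real.log x + (1 / x + 1 / (x + N)) / 2 ≤
      ∑ j ∈ Finset.range (N + 1), 1 / (x + j) := by
    intro N
    induction N with
    | zero => simp
    | succ N ih =>
      rw [Finset.sum_range_succ]
      have hN : (0 : ℝ) ≤ N := Nat.cast_nonneg N
      have := log_sub_le_trapezoid (y := x + N) (by linarith)
      push_cast
      rw [← add_assoc]
      linarith
  have h1 := hsum (n + 1)
  have hpos : 0 ≤ 1 / (x + (n + 1 : ℕ)) := by positivity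
  have e : x + (n + 1 : ℕ) = n + (x + 1) := by push_cast; ring
  have e2 : 1 / (2 * x) = 1 / x / 2 := by rw [div_div, mul_comm]
  rw [e] at h1 hpos
  rw [e2]
  linarith

lemma re_one_div_sq_le {w : ℂ} (hre : 1 / 4 ≤ w.re) (him : 5 ≤ w.im) :
    (1 / w ^ 2).re ≤ ((1 / (w - 1 / 2)).re - (1 / (w + 1 / 2)).re) +
      1 / w.im ^ 2 * (1 / (w.re + w.im - 1 / 2) - 1 / (w.re + w.im + 1 / 2)) := by
  set y := w.re
  set τ := w.im
  have hne : ∀ v : ℂ, v.im = τ → v ≠ 0 := fun v hv h => by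
    rw [h] at hv
    simp at hv
    linarith
  have h0 : w ≠ 0 := hne w rfl
  have h1 : w - 1 / 2 ≠ 0 := hne _ (by simp [τ])
  have h2 : w + 1 / 2 ≠ 0 := hne _ (by simp [τ])
  have hfact : w ^ 2 - 1 / 4 = (w - 1 / 2) * (w + 1 / 2) := by ring
  have h3 : w ^ 2 - 1 / 4 ≠ 0 := hfact ▸ mul_ne_zero h1 h2
  have key : 1 / w ^ 2 =
      1 / (w - 1 / 2) - 1 / (w + 1 / 2) - (1 / 4) / (w ^ 2 * (w ^ 2 - 1 / 4)) := by
    have : 1 / (w - 1 / 2) - 1 / (w + 1 / 2) = 1 / (w ^ 2 - 1 / 4) := by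
      rw [hfact, div_sub_div _ _ h1 h2]
      congr 1
      ring
    rw [this, div_sub_div _ _ h3 (mul_ne_zero (pow_ne_zero 2 h0) h3),
      div_eq_div_iff (pow_ne_zero 2 h0) (mul_ne_zero h3 (mul_ne_zero (pow_ne_zero 2 h0) h3))]
    ring
  have hns : ‖w‖ ^ 2 = y ^ 2 + τ ^ 2 := by
    rw [← normSq_eq_norm_sq, normSq_apply]
    ring
  have b1 : τ ^ 2 / 2 ≤ ‖w ^ 2 - 1 / 4‖ := by
    have := norm_sub_norm_le (w ^ 2) (1 / 4)
    have e : ‖(1 / 4 : ℂ)‖ = 1 / 4 := by norm_num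
    rw [norm_pow, hns, e] at this
    nlinarith
  have b2 : (y + τ) ^ 2 / 2 ≤ ‖w ^ 2‖ := by
    rw [norm_pow, hns]
    nlinarith [sq_nonneg (y - τ)]
  have hyτ : 0 < y + τ := by linarith
  have hτ : 0 < τ := by linarith
  have herr : ‖(1 / 4) / (w ^ 2 * (w ^ 2 - 1 / 4))‖ ≤ 1 / τ ^ 2 * (1 / (y + τ) ^ 2) := by
    rw [norm_div, norm_mul]
    have e : ‖(1 / 4 : ℂ)‖ = 1 / 4 := by norm_num
    rw [e]
    calc (1 / 4 : ℝ) / (‖w ^ 2‖ * ‖w ^ 2 - 1 / 4‖) ≤ (1 / 4) / ((y + τ) ^ 2 / 2 * (τ ^ 2 / 2)) := by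
          gcongr
      _ = _ := by field_simp; norm_num
  have htel : 1 / (y + τ) ^ 2 ≤ 1 / (y + τ - 1 / 2) - 1 / (y + τ + 1 / 2) := by
    have p1 : 0 < y + τ - 1 / 2 := by linarith
    have p2 : 0 < y + τ + 1 / 2 := by linarith
    rw [div_sub_div _ _ p1.ne' p2.ne', div_le_div_iff₀ (by positivity) (by positivity)]
    nlinarith
  have hre1 := abs_re_le_norm ((1 / 4) / (w ^ 2 * (w ^ 2 - 1 / 4)))
  have hre2 := (abs_le.1 (hre1.trans herr)).1
  rw [key, sub_re, sub_re]
  have := mul_le_mul_of_nonneg_left htel (by positivity : 0 ≤ 1 / τ ^ 2)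
  linarith

lemma re_deriv_digamma_nonpos {s : ℂ} (hre : s.re = 1 / 4) (him : 5 ≤ s.im) :
    (deriv digamma s).re ≤ 0 := by
  refine le_of_tendsto' ((continuous_re.tendsto _).comp
    (tendsto_deriv_digamma (s := s) (by rw [hre]; norm_num))) fun n => ?_
  simp only [Function.comp_apply, re_sum]
  set τ := s.im with hτ
  set N := n + 2
  have hN : (2 : ℝ) ≤ N := by simp [N]
  have hj : ∀ j : ℕ, (1 / (s + j) ^ 2).re ≤
      -((1 / (s - 1 / 2 + ((j + 1 : ℕ) : ℂ))).re - (1 / (s - 1 / 2 + (j : ℂ))).re) -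
      1 / τ ^ 2 * (1 / (τ - 1 / 4 + ((j + 1 : ℕ) : ℝ)) - 1 / (τ - 1 / 4 + (j : ℝ))) := by
    intro j
    have hj0 : (0 : ℝ) ≤ j := Nat.cast_nonneg j
    have h := re_one_div_sq_le (w := s + j) (by simp [hre]) (by simpa using him)
    have i1 : (s + j).im = τ := by simp [hτ]
    have i2 : (s + j).re = 1 / 4 + j := by simp [hre]
    rw [i1, i2] at h
    refine h.trans (le_of_eq ?_)
    push_cast
    ring_nf
  refine (Finset.sum_le_sum fun j _ => hj j).trans ?_
  rw [Finset.sum_sub_distrib, Finset.sum_neg_distrib, ← Finset.mul_sum,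
    Finset.sum_range_sub (fun j : ℕ => (1 / (s - 1 / 2 + (j : ℂ))).re),
    Finset.sum_range_sub (fun j : ℕ => 1 / (τ - 1 / 4 + (j : ℝ)))]
  have e1 : (1 / (s - 1 / 2 + ((0 : ℕ) : ℂ))).re = -(1 / 4) / (1 / 16 + τ ^ 2) := by
    rw [one_div, inv_re, normSq_apply]
    simp [hre, ← hτ]
    ring
  have e2 : 0 ≤ (1 / (s - 1 / 2 + (N : ℂ))).re := by
    rw [one_div, inv_re]
    refine div_nonneg ?_ (normSq_nonneg _)
    simp [hre]
    linarith
  have e3 : 0 ≤ 1 / (τ - 1 / 4 + (N : ℝ)) := one_div_nonneg.2 (by linarith)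
  have e4 : 1 / τ ^ 2 * (1 / (τ - 1 / 4 + ((0 : ℕ) : ℝ))) ≤ (1 / 4) / (1 / 16 + τ ^ 2) := by
    have hτ0 : 0 < τ := by linarith
    have hτ1 : 0 < τ - 1 / 4 := by linarith
    rw [Nat.cast_zero, add_zero, div_mul_div_comm, one_mul,
      div_le_div_iff₀ (by positivity) (by positivity)]
    nlinarith
  have e5 : 0 ≤ 1 / τ ^ 2 * (1 / (τ - 1 / 4 + (N : ℝ))) := mul_nonneg (by positivity) e3
  rw [e1]
  have e6 : -(1 / 4) / (1 / 16 + τ ^ 2) = -((1 / 4) / (1 / 16 + τ ^ 2)) := neg_div _ _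
  rw [e6]
  linarith

/-! ### The logarithmic derivative on the imaginary axis -/

lemma hasSum_vonMangoldt {s : ℝ} (hs : 1 < s) :
    HasSum (fun n : ℕ => ArithmeticFunction.vonMangoldt n * (n : ℝ) ^ (-s))
      (-(logDeriv riemannZeta s).re) := by
  have hs' : 1 < (s : ℂ).re := by simpa
  have h := (ArithmeticFunction.LSeriesSummable_vonMangoldt hs').LSeriesHasSum
  rw [LSeriesHasSum, ArithmeticFunction.LSeries_vonMangoldt_eq_deriv_riemannZeta_div hs'] at h
  have h' := hasSum_re h
  rw [neg_div, neg_re, ← logDeriv_apply] at h'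
  convert h' using 2 with n
  rcases Nat.eq_zero_or_pos n with rfl | hn
  · simp
  rw [LSeries.term_of_ne_zero hn.ne', ← ofReal_natCast n, ← ofReal_cpow (Nat.cast_nonneg n),
    ← ofReal_div, ofReal_re, Real.rpow_neg (Nat.cast_nonneg n), div_eq_mul_inv]

lemma neg_logDeriv_zeta_ge {s : ℝ} (hs : 1 < s) :
    Real.log 2 * (2 : ℝ) ^ (-s) ≤ -(logDeriv riemannZeta s).re := by
  have h := le_hasSum (hasSum_vonMangoldt hs) 2 fun n _ =>
    mul_nonneg ArithmeticFunction.vonMangoldt_nonneg (by positivity)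
  rw [ArithmeticFunction.vonMangoldt_apply_prime Nat.prime_two] at h
  exact_mod_cast h

lemma neg_logDeriv_zeta_le {s : ℝ} (hs : 3 ≤ s) :
    -(logDeriv riemannZeta s).re ≤ (2 : ℝ) ^ (3 - s) * (Real.pi ^ 2 / 6 - 1) := by
  have h := hasSum_vonMangoldt (by linarith : 1 < s)
  have hz := ((hasSum_zeta_two).sub (hasSum_ite_eq 1 (1 : ℝ))).mul_left ((2 : ℝ) ^ (3 - s))
  refine hasSum_le (fun n => ?_) h hz
  rcases Nat.lt_or_ge n 2 with hn | hn
  · interval_cases n <;> simp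
  have hn' : (2 : ℝ) ≤ n := by exact_mod_cast hn
  rw [if_neg (by omega), sub_zero]
  have h1 : ArithmeticFunction.vonMangoldt n ≤ n :=
    ArithmeticFunction.vonMangoldt_le_log.trans (Real.log_le_self (by linarith))
  calc ArithmeticFunction.vonMangoldt n * (n : ℝ) ^ (-s) ≤ n * (n : ℝ) ^ (-s) := by gcongr
    _ = (n : ℝ) ^ (3 - s) * (1 / (n : ℝ) ^ 2) := by
      have e : (n : ℝ) ^ (3 - s) = (n : ℝ) ^ 3 * (n : ℝ) ^ (-s) := by
        rw [sub_eq_add_neg, Real.rpow_add (by linarith)]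
        norm_cast
      rw [e]
      field_simp
    _ ≤ _ := by
      gcongr ?_ * _
      exact Real.rpow_le_rpow_of_nonpos (by norm_num) hn' (by linarith)

lemma logDeriv_xiLine_im {a : ℝ} (ha : 1 / 2 < a) :
    (logDeriv xiLine (-(a * I))).im = 1 / (a + 1 / 2) + 1 / (a - 1 / 2) - Real.log Real.pi / 2 +
      (digamma ((a / 2 + 1 / 4 : ℝ) : ℂ)).re / 2 +
      (logDeriv riemannZeta ((a + 1 / 2 : ℝ) : ℂ)).re := by
  set s : ℂ := ((a + 1 / 2 : ℝ) : ℂ) with hs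
  set H : ℂ → ℂ := fun s => s * (s - 1) * ((Real.pi : ℂ) ^ (-s / 2) * Gamma (s / 2)) * riemannZeta s
  have hz0 : 1 / 2 + I * -(a * I) = s := by
    rw [hs]; push_cast; ring_nf; rw [I_sq]; ring
  have hsre : s.re = a + 1 / 2 := by simp [hs]
  have hev : xiLine =ᶠ[𝓝 (-(a * I))] fun z => H (1 / 2 + I * z) := by
    have hopen : IsOpen {z : ℂ | 1 < (1 / 2 + I * z).re} :=
      isOpen_lt continuous_const (by fun_prop)
    filter_upwards [hopen.mem_nhds
      (by change 1 < (1 / 2 + I * -(a * I)).re; rw [hz0, hsre]; linarith)] with z hz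
    change 1 < (1 / 2 + I * z).re at hz
    have e : -(z ^ 2 + 1 / 4) = (1 / 2 + I * z) * (1 / 2 + I * z - 1) := by
      ring_nf; rw [I_sq]; ring
    have n0 : 1 / 2 + I * z ≠ 0 := fun h => by rw [h] at hz; norm_num at hz
    have n1 : 1 / 2 + I * z ≠ 1 := fun h => by rw [h] at hz; norm_num at hz
    rw [xiLine_eq n0 n1, e]
    simp only [H]
    rw [← Gammaℝ_def, riemannZeta_def_of_ne_zero n0]
    have := Gammaℝ_ne_zero_of_re_pos (by linarith : 0 < (1 / 2 + I * z).re)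
    generalize (1 / 2 + I * z : ℂ) = u at this
    field_simp
  have s0 : s ≠ 0 := fun h => by rw [h] at hsre; simp at hsre; linarith
  have s1 : s - 1 ≠ 0 := fun h => by
    have := congrArg re h; rw [sub_re, hsre] at this; simp at this; linarith
  have hζ : riemannZeta s ≠ 0 := riemannZeta_ne_zero_of_one_lt_re (by rw [hsre]; linarith)
  have hπ : (Real.pi : ℂ) ≠ 0 := ofReal_ne_zero.2 Real.pi_ne_zero
  have hp0 : (Real.pi : ℂ) ^ (-s / 2) ≠ 0 := by simp [hπ]
  have hs2 : 0 < (s / 2).re := by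
    have : s / 2 = ((a / 2 + 1 / 4 : ℝ) : ℂ) := by rw [hs]; push_cast; ring
    rw [this, ofReal_re]; linarith
  have hG0 : Gamma (s / 2) ≠ 0 := Gamma_ne_zero_of_re_pos hs2
  have dG : DifferentiableAt ℂ Gamma (s / 2) := by
    refine differentiableAt_Gamma _ fun m hm => ?_
    rw [hm] at hs2
    simp at hs2
    have : (0 : ℝ) ≤ m := Nat.cast_nonneg m
    linarith
  have dG' : HasDerivAt (fun s : ℂ => Gamma (s / 2)) (deriv Gamma (s / 2) * (1 / 2)) s :=
    dG.hasDerivAt.comp s ((hasDerivAt_id s).div_const 2)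
  have dP : HasDerivAt (fun s : ℂ => (Real.pi : ℂ) ^ (-s / 2))
      ((Real.pi : ℂ) ^ (-s / 2) * Complex.log Real.pi * (-1 / 2)) s :=
    (((hasDerivAt_id s).neg).div_const 2).const_cpow (Or.inl hπ)
  have dζ := (differentiableAt_riemannZeta (sub_ne_zero.1 s1)).hasDerivAt
  have dH := (((hasDerivAt_id s).mul ((hasDerivAt_id s).sub_const 1)).mul (dP.mul dG')).mul dζ
  have dL : HasDerivAt (fun z : ℂ => 1 / 2 + I * z) I (-(a * I)) := by
    simpa using ((hasDerivAt_id (-(a * I))).const_mul I).const_add (1 / 2)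
  rw [← hz0] at dH
  have hc := HasDerivAt.comp (-(a * I)) dH dL
  rw [hz0] at hc
  have key : logDeriv xiLine (-(a * I)) = I * (1 / s + 1 / (s - 1) - Complex.log Real.pi / 2 +
      digamma (s / 2) / 2 + logDeriv riemannZeta s) := by
    have h : deriv (fun z => H (1 / 2 + I * z)) (-(a * I)) = _ := hc.deriv
    rw [logDeriv_apply, hev.eq_of_nhds, hev.deriv_eq, h]
    simp only [H, hz0, digamma_def, logDeriv_apply, id, Pi.mul_apply]
    generalize deriv riemannZeta s = dz at *
    generalize deriv Gamma (s / 2) = dg at *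
    generalize Gamma (s / 2) = g at *
    generalize riemannZeta s = ζ at *
    generalize (Real.pi : ℂ) ^ (-s / 2) = p at *
    field_simp
    ring
  have e1 : s = ((a + 1 / 2 : ℝ) : ℂ) := hs
  have e2 : s / 2 = ((a / 2 + 1 / 4 : ℝ) : ℂ) := by rw [hs]; push_cast; ring
  have e3 : (1 / s).re = 1 / (a + 1 / 2) := by
    rw [e1, ← ofReal_one, ← ofReal_div, ofReal_re]
  have e4 : (1 / (s - 1)).re = 1 / (a - 1 / 2) := by
    rw [e1, ← ofReal_one, ← ofReal_sub, ← ofReal_div, ofReal_re]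
    congr 1
    ring
  have e5 : (Complex.log Real.pi / 2).re = Real.log Real.pi / 2 := by
    rw [← ofReal_log Real.pi_pos.le, ← ofReal_ofNat, ← ofReal_div, ofReal_re]
  have e6 : (digamma (s / 2) / 2).re = (digamma (s / 2)).re / 2 := by
    rw [← ofReal_ofNat, div_ofReal_re]
  rw [key, I_mul_im, add_re, add_re, sub_re, add_re, e3, e4, e5, e6, e2]

lemma pi_sq_div_six_sub_one_le : Real.pi ^ 2 / 6 - 1 ≤ 0.64495 := by
  nlinarith [Real.pi_gt_three, Real.pi_lt_d4]

lemma logDeriv_xiLine_im_five_le :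
    (logDeriv xiLine (-((11 / 2 : ℝ) * I))).im ≤
      1 / 6 + 1 / 5 - Real.log Real.pi / 2 + (Real.log 3 - 1 / 6) / 2 - Real.log 2 / 64 := by
  rw [logDeriv_xiLine_im (by norm_num)]
  have h1 := digamma_le_log_sub (x := 11 / 2 / 2 + 1 / 4) (by norm_num)
  have h2 := neg_logDeriv_zeta_ge (s := 11 / 2 + 1 / 2) (by norm_num)
  have e1 : (11 / 2 / 2 + 1 / 4 : ℝ) = 3 := by norm_num
  have e2 : (11 / 2 + 1 / 2 : ℝ) = 6 := by norm_num
  have e3 : (2 : ℝ) ^ (-6 : ℝ) = 1 / 64 := by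
    rw [Real.rpow_neg (by norm_num)]
    norm_num
  rw [e1] at h1 ⊢
  rw [e2] at h2 ⊢
  rw [e3] at h2
  norm_num at h1 h2 ⊢
  linarith

lemma logDeriv_xiLine_im_eleven_ge :
    1 / 12 + 1 / 11 - Real.log Real.pi / 2 + Real.log (11 / 2) / 2 - 0.0013 ≤
      (logDeriv xiLine (-((23 / 2 : ℝ) * I))).im := by
  rw [logDeriv_xiLine_im (by norm_num)]
  have h1 := log_sub_half_le_digamma (x := 23 / 2 / 2 + 1 / 4) (by norm_num)
  have h2 := neg_logDeriv_zeta_le (s := 23 / 2 + 1 / 2) (by norm_num)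
  have h3 := pi_sq_div_six_sub_one_le
  have e1 : (23 / 2 / 2 + 1 / 4 : ℝ) = 6 := by norm_num
  have e2 : (23 / 2 + 1 / 2 : ℝ) = 12 := by norm_num
  have e3 : (2 : ℝ) ^ (3 - 12 : ℝ) = 1 / 512 := by
    rw [show (3 - 12 : ℝ) = -9 by norm_num, Real.rpow_neg (by norm_num)]
    norm_num
  have e4 : (6 - 1 / 2 : ℝ) = 11 / 2 := by norm_num
  rw [e1] at h1 ⊢
  rw [e2] at h2 ⊢
  rw [e3] at h2
  rw [e4] at h1
  norm_num at h1 h2 h3 ⊢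
  linarith

lemma ten_le_of_xiLine_eq_zero (F : RealZeroFactorization xiLine) {γ : ℝ} (hγ : 0 < γ)
    (h : xiLine γ = 0) : 10 ≤ γ := by
  by_contra! hlt
  have hb : xiLine ((1 / 2 : ℝ) * I) ≠ 0 := by rw [xiLine_I_half]; exact one_ne_zero
  have hc := F.zero_contribution_le differentiable_xiLine xiLine_neg hb hγ h
    (by norm_num : (0 : ℝ) < 11 / 2) (by norm_num : (11 / 2 : ℝ) ≤ 23 / 2)
  have hu := logDeriv_xiLine_im_five_le
  have hl := logDeriv_xiLine_im_eleven_ge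
  have hu' := div_le_div_of_nonneg_right hu (by norm_num : (0 : ℝ) ≤ 11 / 2)
  have hl' := div_le_div_of_nonneg_right hl (by norm_num : (0 : ℝ) ≤ 23 / 2)
  have hpi : 1 - 3 / Real.pi ≤ Real.log Real.pi - Real.log 3 := by
    rw [← Real.log_div Real.pi_ne_zero (by norm_num)]
    simpa using Real.one_sub_inv_le_log_of_pos (by positivity : 0 < Real.pi / 3)
  have hpi' : 3 / Real.pi ≤ 3 / 3.14 := by gcongr; exact Real.pi_gt_d2.le
  have hlog : Real.log 2 - 1 / 11 ≤ Real.log (11 / 2) - Real.log 3 := by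
    have := Real.one_sub_inv_le_log_of_pos (by norm_num : (0 : ℝ) < 11 / 12)
    have e : (11 / 2 : ℝ) = 11 / 12 * (2 * 3) := by norm_num
    rw [e, Real.log_mul (by norm_num) (by norm_num), Real.log_mul (by norm_num) (by norm_num)]
    norm_num at this ⊢
    linarith
  have hlog2 := Real.log_two_gt_d9
  have hp : γ ^ 2 < 100 := by nlinarith
  have hmain : 0.0067 ≤ 2 * (1 / ((11 / 2) ^ 2 + γ ^ 2) - 1 / ((23 / 2) ^ 2 + γ ^ 2)) := by
    rw [div_sub_div _ _ (by positivity) (by positivity), ← mul_div_assoc,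
      le_div_iff₀ (by positivity)]
    nlinarith [sq_nonneg γ]
  linarith

lemma four_div_sq_le {γ : ℝ} (hγ : 10 ≤ γ) :
    4 / γ ^ 2 ≤ (logDeriv xiLine (-(γ * I))).im / γ := by
  have hγ0 : 0 < γ := by linarith
  rw [div_le_div_iff₀ (by positivity) hγ0, logDeriv_xiLine_im (by linarith)]
  have h1 := log_sub_half_le_digamma (x := γ / 2 + 1 / 4) (by linarith)
  have h2 := neg_logDeriv_zeta_le (s := γ + 1 / 2) (by linarith)
  have h3 := pi_sq_div_six_sub_one_le
  have hpow : (2 : ℝ) ^ (3 - (γ + 1 / 2)) ≤ 0.00553 := by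
    have hle : (2 : ℝ) ^ (3 - (γ + 1 / 2)) ≤ 2 ^ (-(15 / 2) : ℝ) :=
      Real.rpow_le_rpow_of_exponent_le (by norm_num) (by linarith)
    have hsq : ((2 : ℝ) ^ (-(15 / 2) : ℝ)) ^ 2 = 1 / 32768 := by
      rw [← Real.rpow_natCast, ← Real.rpow_mul (by norm_num),
        show (-(15 / 2) * ((2 : ℕ) : ℝ) : ℝ) = -15 by norm_num, Real.rpow_neg (by norm_num)]
      norm_num
    have := Real.rpow_pos_of_pos (by norm_num : (0 : ℝ) < 2) (-(15 / 2))
    nlinarith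
  have hε : (2 : ℝ) ^ (3 - (γ + 1 / 2)) * (Real.pi ^ 2 / 6 - 1) ≤ 0.00553 * 0.64495 := by
    refine mul_le_mul hpow h3 ?_ (by norm_num)
    nlinarith [Real.pi_gt_three]
  have hlog : Real.log (19 / 4) ≤ Real.log (γ / 2 + 1 / 4 - 1 / 2) :=
    Real.log_le_log (by norm_num) (by linarith)
  have hpi : Real.log Real.pi ≤ Real.log 3.1416 := Real.log_le_log Real.pi_pos Real.pi_lt_d4.le
  have hnum : 0.4075 ≤ Real.log (19 / 4) - Real.log 3.1416 := by
    rw [← Real.log_div (by norm_num) (by norm_num)]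
    have := Real.le_log_one_add_of_nonneg (x := 19 / 4 / 3.1416 - 1) (by norm_num)
    norm_num at this ⊢
    linarith
  have hrat : 2 / γ ≤ 1 / (γ + 1 / 2) + 1 / (γ - 1 / 2) := by
    rw [div_add_div _ _ (by linarith) (by linarith), div_le_div_iff₀ hγ0 (by nlinarith)]
    nlinarith
  have hsum : 2 / γ + 0.2 ≤ 1 / (γ + 1 / 2) + 1 / (γ - 1 / 2) - Real.log Real.pi / 2 +
      (digamma ((γ / 2 + 1 / 4 : ℝ) : ℂ)).re / 2 +
      (logDeriv riemannZeta ((γ + 1 / 2 : ℝ) : ℂ)).re := by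
    norm_num at hε hnum ⊢
    norm_num at hrat h1 h2 hlog hpi
    linarith
  have h4 := mul_le_mul_of_nonneg_right hsum (by positivity : 0 ≤ γ ^ 2)
  have e : (2 / γ + 0.2) * γ ^ 2 = (2 + 0.2 * γ) * γ := by field_simp
  nlinarith

/-! ### Hardy's function in terms of `xiLine` -/

lemma Gammaℝ_conj (s : ℂ) : Gammaℝ (conj s) = conj (Gammaℝ s) := by
  rw [Gammaℝ_def, Gammaℝ_def, map_mul, ← Gamma_conj, map_div₀, conj_ofNat]
  congr 1
  rw [show -(conj s) / 2 = conj (-s / 2) by simp [conj_ofNat],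
    cpow_conj _ _ (by rw [arg_ofReal_of_nonneg Real.pi_pos.le]; exact Real.pi_ne_zero.symm),
    conj_ofReal]

lemma conj_criticalLine (t : ℝ) : conj (1 / 2 + I * t) = 1 - (1 / 2 + I * t) := by
  simp [conj_ofNat]
  ring

lemma criticalLine_re (t : ℝ) : (1 / 2 + I * t : ℂ).re = 1 / 2 := by simp

lemma Gammaℝ_criticalLine_ne_zero (t : ℝ) : Gammaℝ (1 / 2 + I * t) ≠ 0 :=
  Gammaℝ_ne_zero_of_re_pos (by rw [criticalLine_re]; norm_num)

lemma criticalLine_ne_zero (t : ℝ) : (1 / 2 + I * t : ℂ) ≠ 0 := fun h => by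
  have := congrArg re h
  rw [criticalLine_re] at this
  norm_num at this

lemma criticalLine_ne_one (t : ℝ) : (1 / 2 + I * t : ℂ) ≠ 1 := fun h => by
  have := congrArg re h
  rw [criticalLine_re] at this
  norm_num at this

lemma xiLine_ofReal_eq (t : ℝ) : xiLine t =
    -(t ^ 2 + 1 / 4 : ℝ) * (Gammaℝ (1 / 2 + I * t) * riemannZeta (1 / 2 + I * t)) := by
  rw [xiLine_eq (criticalLine_ne_zero t) (criticalLine_ne_one t),
    riemannZeta_def_of_ne_zero (criticalLine_ne_zero t),
    mul_div_cancel₀ _ (Gammaℝ_criticalLine_ne_zero t)]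
  push_cast
  rfl

lemma conj_xiLine_ofReal (t : ℝ) : conj (xiLine t) = xiLine t := by
  have h : conj (completedRiemannZeta (1 / 2 + I * t)) =
      completedRiemannZeta (1 / 2 + I * t) := by
    have e : ∀ t : ℝ, completedRiemannZeta (1 / 2 + I * t) =
        Gammaℝ (1 / 2 + I * t) * riemannZeta (1 / 2 + I * t) := fun t => by
      rw [riemannZeta_def_of_ne_zero (criticalLine_ne_zero t),
        mul_div_cancel₀ _ (Gammaℝ_criticalLine_ne_zero t)]
    have e' : conj (1 / 2 + I * t) = 1 / 2 + I * (-t : ℝ) := by simp [conj_ofNat]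
    conv_lhs => rw [e t, map_mul, ← Gammaℝ_conj, ← riemannZeta_conj, e', ← e (-t),
      ← completedRiemannZeta_one_sub]
    congr 1
    push_cast
    ring
  rw [xiLine_eq (criticalLine_ne_zero t) (criticalLine_ne_one t), map_mul, h]
  simp [conj_ofNat]

lemma ofReal_xiLine_re (t : ℝ) : ((xiLine t).re : ℂ) = xiLine t :=
  conj_eq_iff_re.1 (conj_xiLine_ofReal t)

lemma exp_RStheta_sq_mul (t : ℝ) :
    exp (I * RStheta t) ^ 2 * conj (Gammaℝ (1 / 2 + I * t)) = Gammaℝ (1 / 2 + I * t) := by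
  set G := Gamma (1 / 4 + I * t / 2) with hG
  have hG0 : G ≠ 0 := Gamma_ne_zero_of_re_pos (by simp)
  have hconj : Gamma (1 / 4 - I * t / 2) = conj G := by
    rw [hG, ← Gamma_conj]
    congr 1
    simp [sub_eq_add_neg, neg_div, conj_ofNat]
  have hG0' : conj G ≠ 0 := (map_ne_zero _).2 hG0
  have hnorm : ‖G / conj G‖ = 1 := by
    rw [norm_div, norm_conj, div_self (norm_ne_zero_iff.2 hG0)]
  have hθ : RStheta t = arg (G / conj G) / 2 - t / 2 * Real.log Real.pi := by
    rw [RStheta, ← hG, hconj]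
    congr 1
    have : (1 / (2 * I) : ℂ) = -(I / 2) := by
      rw [div_eq_iff (by simp)]
      ring_nf
      rw [I_sq]
      norm_num
    rw [this]
    simp [log_im]
    ring
  have hexp : exp (I * RStheta t) ^ 2 = G / conj G * exp (-(I * t * Real.log Real.pi)) := by
    have h := norm_mul_exp_arg_mul_I (G / conj G)
    rw [hnorm, ofReal_one, one_mul] at h
    rw [← exp_nat_mul, hθ]
    nth_rewrite 2 [← h]
    rw [← exp_add]
    congr 1
    push_cast
    ring
  have hs : (1 / 2 + I * t : ℂ) / 2 = 1 / 4 + I * t / 2 := by ring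
  have hπ : (Real.pi : ℂ) ≠ 0 := ofReal_ne_zero.2 Real.pi_ne_zero
  rw [hexp, ← Gammaℝ_conj, conj_criticalLine, Gammaℝ_def, Gammaℝ_def, hs, ← hG,
    show (1 - (1 / 2 + I * t) : ℂ) / 2 = 1 / 4 - I * t / 2 by ring, hconj,
    cpow_def_of_ne_zero hπ, cpow_def_of_ne_zero hπ, ← ofReal_log Real.pi_pos.le]
  have he : exp (Real.log Real.pi * (-(1 / 2 + I * t) / 2)) =
      exp (-(I * t * Real.log Real.pi)) *
        exp (Real.log Real.pi * (-(1 - (1 / 2 + I * t)) / 2)) := by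
    rw [← exp_add]
    congr 1
    ring
  rw [he]
  field_simp

/-- The positive factor relating Hardy's function to `xiLine`. -/
noncomputable def hardyAmplitude (t : ℝ) : ℝ := ((t ^ 2 + 1 / 4) * ‖Gammaℝ (1 / 2 + I * t)‖)⁻¹

lemma exists_HardyZ_eq (t : ℝ) : ∃ σ : ℝ, (σ = 1 ∨ σ = -1) ∧
    HardyZ t = σ * (hardyAmplitude t * (xiLine t).re) := by
  set Γ := Gammaℝ (1 / 2 + I * t) with hΓ
  have hΓ0 : Γ ≠ 0 := Gammaℝ_criticalLine_ne_zero t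
  have hn0 : ‖Γ‖ ≠ 0 := norm_ne_zero_iff.2 hΓ0
  have hq : (t ^ 2 + 1 / 4 : ℝ) ≠ 0 := by positivity
  have hsq : (exp (I * RStheta t) * ‖Γ‖) ^ 2 = Γ ^ 2 := by
    rw [mul_pow, ← ofReal_pow, ← normSq_eq_norm_sq, ← mul_conj]
    have := exp_RStheta_sq_mul t
    rw [← hΓ] at this
    rw [mul_left_comm, this, sq]
  have hξ := xiLine_ofReal_eq t
  rw [← hΓ] at hξ
  obtain ⟨σ, hσ, hσe⟩ : ∃ σ : ℝ, (σ = 1 ∨ σ = -1) ∧ exp (I * RStheta t) * ‖Γ‖ = -σ * Γ := by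
    rcases sq_eq_sq_iff_eq_or_eq_neg.1 hsq with h | h
    · exact ⟨-1, Or.inr rfl, by simpa using h⟩
    · exact ⟨1, Or.inl rfl, by simpa using h⟩
  refine ⟨σ, hσ, ?_⟩
  have hn0' : (‖Γ‖ : ℂ) ≠ 0 := ofReal_ne_zero.2 hn0
  have hq' : ((t ^ 2 + 1 / 4 : ℝ) : ℂ) ≠ 0 := ofReal_ne_zero.2 hq
  have key : exp (I * RStheta t) * riemannZeta (1 / 2 + I * t) =
      ((σ * (hardyAmplitude t * (xiLine t).re) : ℝ) : ℂ) := by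
    rw [hardyAmplitude, ← hΓ, ofReal_mul, ofReal_mul, ofReal_xiLine_re, hξ, ofReal_inv, ofReal_mul]
    generalize riemannZeta (1 / 2 + I * t) = ζ
    generalize ((t ^ 2 + 1 / 4 : ℝ) : ℂ) = q at *
    generalize exp (I * RStheta t) = e at *
    have : e = -σ * Γ / ‖Γ‖ := by rw [← hσe, mul_div_cancel_right₀ _ hn0']
    rw [this]
    field_simp
  rw [HardyZ, key, ofReal_re]

/-! ### Simple zeros of a function known up to sign -/

lemma simple_zero_of_sign {f w : ℝ → ℝ} {γ : ℝ} (hw : ContinuousAt w γ)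
    (hf : ∀ t, ∃ σ : ℝ, (σ = 1 ∨ σ = -1) ∧ f t = σ * ((t - γ) * w t))
    (hd : deriv f γ ≠ 0) :
    w γ ≠ 0 ∧ ∃ c : ℝ, c ≠ 0 ∧ f =ᶠ[𝓝 γ] fun t => c * ((t - γ) * w t) := by
  choose σ hσ hfσ using hf
  have hfγ : f γ = 0 := by rw [hfσ, sub_self, zero_mul, mul_zero]
  have hslope : Tendsto (slope f γ) (𝓝[≠] γ) (𝓝 (deriv f γ)) :=
    hasDerivAt_iff_tendsto_slope.1 (differentiableAt_of_deriv_ne_zero hd).hasDerivAt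
  have hs : ∀ t, t ≠ γ → slope f γ t = σ t * w t := fun t ht => by
    rw [slope_def_field, hfγ, sub_zero, hfσ]
    have := sub_ne_zero.2 ht
    field_simp
  have hσabs : ∀ t, |σ t| = 1 := fun t => by rcases hσ t with h | h <;> simp [h]
  have hw' : Tendsto w (𝓝[≠] γ) (𝓝 (w γ)) := hw.tendsto.mono_left nhdsWithin_le_nhds
  have hslope' : Tendsto (fun t => σ t * w t) (𝓝[≠] γ) (𝓝 (deriv f γ)) := by
    refine hslope.congr' ?_
    filter_upwards [self_mem_nhdsWithin] with t ht using hs t ht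
  have habs : |deriv f γ| = |w γ| := by
    refine tendsto_nhds_unique hslope'.abs (hw'.abs.congr fun t => ?_)
    rw [abs_mul, hσabs, one_mul]
  have hwγ : w γ ≠ 0 := fun h => hd (by simpa [h] using habs)
  refine ⟨hwγ, deriv f γ / w γ, div_ne_zero hd hwγ, ?_⟩
  set c := deriv f γ / w γ with hc
  have hcabs : |c| = 1 := by rw [hc, abs_div, habs, div_self (abs_ne_zero.2 hwγ)]
  have hσc : Tendsto σ (𝓝[≠] γ) (𝓝 c) := by
    refine (hslope'.div hw' hwγ).congr' ?_
    filter_upwards [hw'.eventually_ne hwγ] with t ht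
    exact mul_div_cancel_right₀ _ ht
  have hev : ∀ᶠ t in 𝓝[≠] γ, σ t = c := by
    filter_upwards [Metric.tendsto_nhds.1 hσc 1 one_pos] with t ht
    rw [Real.dist_eq, abs_lt] at ht
    rcases hσ t with h | h <;> rcases eq_or_eq_neg_of_abs_eq hcabs with h' | h' <;>
      rw [h, h'] at ht ⊢ <;> norm_num at ht
  rw [eventually_nhdsWithin_iff] at hev
  filter_upwards [hev] with t ht
  rcases eq_or_ne t γ with rfl | hne
  · simp [hfγ]
  · rw [hfσ, ht hne]

lemma schwarzian_of_simple_zero {f w l l₁ : ℝ → ℝ} {c γ : ℝ} (hc : c ≠ 0)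
    (hf : f =ᶠ[𝓝 γ] fun t => c * ((t - γ) * w t))
    (hw : ∀ᶠ t in 𝓝 γ, HasDerivAt w (w t * l t) t) (hl : ∀ᶠ t in 𝓝 γ, HasDerivAt l (l₁ t) t)
    (hl₁ : ContinuousAt l₁ γ) (hwγ : w γ ≠ 0) :
    -(iteratedDeriv 3 f γ / deriv f γ) + 3 / 4 * (iteratedDeriv 2 f γ / deriv f γ) ^ 2 =
      -3 * l₁ γ := by
  have h1 : deriv f =ᶠ[𝓝 γ] fun t => c * (w t + (t - γ) * (w t * l t)) := by
    refine hf.deriv.trans ?_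
    filter_upwards [hw] with t ht
    have := ((((hasDerivAt_id t).sub_const γ).mul ht).const_mul c).deriv
    simp only [id, one_mul] at this
    exact this
  have h2 : deriv (deriv f) =ᶠ[𝓝 γ] fun t =>
      c * (2 * (w t * l t) + (t - γ) * (w t * l t ^ 2 + w t * l₁ t)) := by
    refine h1.deriv.trans ?_
    filter_upwards [hw, hl] with t ht hlt
    have := ((ht.add (((hasDerivAt_id t).sub_const γ).mul (ht.mul hlt))).const_mul c).deriv
    refine this.trans ?_
    simp only [id, Pi.mul_apply]
    ring
  have h3 : HasDerivAt (deriv (deriv f)) (c * (3 * (w γ * l γ ^ 2 + w γ * l₁ γ))) γ := by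
    have hwγ' := hw.self_of_nhds
    have hlγ := hl.self_of_nhds
    have hv : ContinuousAt (fun t => w t * l t ^ 2 + w t * l₁ t) γ :=
      (hwγ'.continuousAt.mul (hlγ.continuousAt.pow 2)).add (hwγ'.continuousAt.mul hl₁)
    have hprod : HasDerivAt (fun t => (t - γ) * (w t * l t ^ 2 + w t * l₁ t))
        (w γ * l γ ^ 2 + w γ * l₁ γ) γ := by
      rw [hasDerivAt_iff_tendsto_slope]
      refine (hv.tendsto.mono_left nhdsWithin_le_nhds).congr' ?_
      filter_upwards [self_mem_nhdsWithin] with t ht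
      have : t - γ ≠ 0 := sub_ne_zero.2 ht
      rw [slope_def_field, sub_self, zero_mul, sub_zero, mul_div_cancel_left₀ _ this]
    have := (((hwγ'.mul hlγ).const_mul 2).add hprod).const_mul c
    refine (this.congr_of_eventuallyEq ?_).congr_deriv (by ring)
    exact h2
  have e1 : deriv f γ = c * w γ := by rw [h1.eq_of_nhds]; ring
  have e2 : iteratedDeriv 2 f γ = c * (2 * (w γ * l γ)) := by
    rw [iteratedDeriv_succ, iteratedDeriv_one, h2.eq_of_nhds]; ring
  have e3 : iteratedDeriv 3 f γ = c * (3 * (w γ * l γ ^ 2 + w γ * l₁ γ)) := by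
    rw [iteratedDeriv_succ, iteratedDeriv_succ, iteratedDeriv_one, h3.deriv]
  rw [e1, e2, e3]
  field_simp
  ring

/-! ### The amplitude -/

lemma hasDerivAt_norm_of_ne_zero {F : ℝ → ℂ} {L : ℂ} {t : ℝ} (hF : HasDerivAt F (F t * L) t)
    (h0 : F t ≠ 0) : HasDerivAt (fun t => ‖F t‖) (‖F t‖ * L.re) t := by
  have hpos : 0 < ‖F t‖ := norm_pos_iff.2 h0
  have h := (hF.norm_sq.sqrt (by positivity))
  simp only [Real.sqrt_sq (norm_nonneg _)] at h
  refine h.congr_deriv ?_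
  have e : inner ℝ (F t) (F t * L) = ‖F t‖ ^ 2 * L.re := by
    rw [Complex.inner, ← normSq_eq_norm_sq, ← re_ofReal_mul, normSq_eq_conj_mul_self]
    congr 1
    ring
  rw [e]
  field_simp

lemma gammaArg_re (t : ℝ) : (1 / 4 + I * t / 2 : ℂ).re = 1 / 4 := by simp

lemma differentiableAt_Gamma_of_re_pos {s : ℂ} (hs : 0 < s.re) : DifferentiableAt ℂ Gamma s :=
  differentiableAt_Gamma _ fun m hm => by
    rw [hm] at hs
    simp at hs
    have : (0 : ℝ) ≤ m := Nat.cast_nonneg m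
    linarith

lemma hasDerivAt_Gammaℝ {s : ℂ} (hs : 0 < s.re) :
    HasDerivAt Gammaℝ (Gammaℝ s * (digamma (s / 2) / 2 - Real.log Real.pi / 2)) s := by
  have hπ : (Real.pi : ℂ) ≠ 0 := ofReal_ne_zero.2 Real.pi_ne_zero
  have hs2 : 0 < (s / 2).re := by rw [← ofReal_ofNat, div_ofReal_re]; positivity
  have hG := Gamma_ne_zero_of_re_pos hs2
  have dG' : HasDerivAt (fun s : ℂ => Gamma (s / 2)) (deriv Gamma (s / 2) * (1 / 2)) s :=
    (differentiableAt_Gamma_of_re_pos hs2).hasDerivAt.comp s ((hasDerivAt_id s).div_const 2)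
  have dP : HasDerivAt (fun s : ℂ => (Real.pi : ℂ) ^ (-s / 2))
      ((Real.pi : ℂ) ^ (-s / 2) * Complex.log Real.pi * (-1 / 2)) s :=
    (((hasDerivAt_id s).neg).div_const 2).const_cpow (Or.inl hπ)
  refine (dP.mul dG').congr_deriv ?_
  rw [Gammaℝ_def, digamma_def, logDeriv_apply, ofReal_log Real.pi_pos.le]
  field_simp
  ring

lemma hasDerivAt_hardyAmplitude (t : ℝ) : HasDerivAt hardyAmplitude
    (hardyAmplitude t * (-(2 * t / (t ^ 2 + 1 / 4)) + (digamma (1 / 4 + I * t / 2)).im / 2)) t := by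
  have hre := criticalLine_re t
  have hL : HasDerivAt (fun t : ℝ => (1 / 2 + I * t : ℂ)) I t := by
    simpa using ((hasDerivAt_id (t : ℂ)).const_mul I).const_add (1 / 2) |>.comp_ofReal
  have hΓ := (hasDerivAt_Gammaℝ (s := 1 / 2 + I * t) (by rw [hre]; norm_num)).comp t hL
  have e2 : (1 / 2 + I * t : ℂ) / 2 = 1 / 4 + I * t / 2 := by ring
  rw [e2, mul_assoc] at hΓ
  have hN := hasDerivAt_norm_of_ne_zero hΓ (Gammaℝ_criticalLine_ne_zero t)
  have hq : HasDerivAt (fun t : ℝ => t ^ 2 + 1 / 4) (2 * t) t := by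
    simpa using ((hasDerivAt_id t).pow 2).add_const (1 / 4)
  have hn0 : 0 < ‖Gammaℝ (1 / 2 + I * t)‖ := norm_pos_iff.2 (Gammaℝ_criticalLine_ne_zero t)
  have hq0 : 0 < t ^ 2 + 1 / 4 := by positivity
  refine ((hq.mul hN).inv (mul_pos hq0 hn0).ne').congr_deriv ?_
  have hLre : ((digamma (1 / 4 + I * t / 2) / 2 - Real.log Real.pi / 2) * I).re =
      -((digamma (1 / 4 + I * t / 2)).im / 2) := by
    have e : (Real.log Real.pi / 2 : ℂ) = ((Real.log Real.pi / 2 : ℝ) : ℂ) := by push_cast; rfl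
    rw [mul_I_re, sub_im, e, ofReal_im, sub_zero, div_ofNat_im]
  simp only [Function.comp_apply, Pi.mul_apply, hLre, hardyAmplitude]
  field_simp
  ring

lemma differentiableOn_digamma : DifferentiableOn ℂ digamma {s | 0 < s.re} := by
  have hopen : IsOpen {s : ℂ | 0 < s.re} := isOpen_lt continuous_const continuous_re
  have hG : DifferentiableOn ℂ Gamma {s | 0 < s.re} := fun s hs =>
    (differentiableAt_Gamma_of_re_pos hs).differentiableWithinAt
  exact (hG.deriv hopen).div hG fun s hs => Gamma_ne_zero_of_re_pos hs

lemma hasDerivAt_logDeriv_hardyAmplitude (t : ℝ) : HasDerivAt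
    (fun t : ℝ => -(2 * t / (t ^ 2 + 1 / 4)) + (digamma (1 / 4 + I * t / 2)).im / 2)
    (2 * (t ^ 2 - 1 / 4) / (t ^ 2 + 1 / 4) ^ 2 + (deriv digamma (1 / 4 + I * t / 2)).re / 4) t := by
  have hopen : IsOpen {s : ℂ | 0 < s.re} := isOpen_lt continuous_const continuous_re
  have hmem : (1 / 4 + I * t / 2 : ℂ) ∈ {s : ℂ | 0 < s.re} := by
    change 0 < (1 / 4 + I * t / 2 : ℂ).re
    rw [gammaArg_re]; norm_num
  have hψ := (differentiableOn_digamma.differentiableAt (hopen.mem_nhds hmem)).hasDerivAt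
  have hL : HasDerivAt (fun t : ℝ => (1 / 4 + I * t / 2 : ℂ)) (I / 2) t := by
    simpa using (((hasDerivAt_id (t : ℂ)).const_mul I).div_const 2).const_add (1 / 4) |>.comp_ofReal
  have him := (imCLM.hasFDerivAt.comp_hasDerivAt t (hψ.comp t hL)).div_const 2
  have hq : HasDerivAt (fun t : ℝ => t ^ 2 + 1 / 4) (2 * t) t := by
    simpa using ((hasDerivAt_id t).pow 2).add_const (1 / 4)
  have hq0 : 0 < t ^ 2 + 1 / 4 := by positivity
  refine ((((hasDerivAt_id t).const_mul 2).div hq hq0.ne').neg.add him).congr_deriv ?_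
  have : (deriv digamma (1 / 4 + I * t / 2) * (I / 2)).im =
      (deriv digamma (1 / 4 + I * t / 2)).re / 2 := by
    rw [mul_div_assoc', div_ofNat_im, mul_I_im]
  simp only [imCLM_apply, this, id]
  field_simp
  ring

lemma continuous_deriv_digamma_line :
    Continuous fun t : ℝ => deriv digamma (1 / 4 + I * t / 2) := by
  have hopen : IsOpen {s : ℂ | 0 < s.re} := isOpen_lt continuous_const continuous_re
  refine (differentiableOn_digamma.deriv hopen).continuousOn.comp_continuous (by fun_prop)
    fun t => ?_
  change 0 < (1 / 4 + I * t / 2 : ℂ).re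
  rw [gammaArg_re]; norm_num

lemma logDeriv_hardyAmplitude_deriv_lt {t : ℝ} (ht : 10 ≤ t) :
    2 * (t ^ 2 - 1 / 4) / (t ^ 2 + 1 / 4) ^ 2 + (deriv digamma (1 / 4 + I * t / 2)).re / 4 <
      2 / t ^ 2 := by
  have h := re_deriv_digamma_nonpos (s := 1 / 4 + I * t / 2) (gammaArg_re t)
    (by simp; linarith)
  have ht0 : 0 < t := by linarith
  have : 2 * (t ^ 2 - 1 / 4) / (t ^ 2 + 1 / 4) ^ 2 < 2 / t ^ 2 := by
    rw [div_lt_div_iff₀ (by positivity) (by positivity)]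
    nlinarith [sq_nonneg t]
  linarith

/-! ### Simple zeros of Hardy's function -/

lemma hardyAmplitude_pos (t : ℝ) : 0 < hardyAmplitude t :=
  inv_pos.2 (mul_pos (by positivity) (norm_pos_iff.2 (Gammaℝ_criticalLine_ne_zero t)))

lemma xiLine_eq_zero_of_HardyZ {γ : ℝ} (h : HardyZ γ = 0) : xiLine γ = 0 := by
  obtain ⟨σ, hσ, e⟩ := exists_HardyZ_eq γ
  have hσ0 : σ ≠ 0 := by rcases hσ with rfl | rfl <;> norm_num
  rw [h, eq_comm, mul_eq_zero, or_iff_right hσ0, mul_eq_zero,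
    or_iff_right (hardyAmplitude_pos γ).ne'] at e
  rw [← ofReal_xiLine_re, e, ofReal_zero]

lemma exists_cofactor_of_isSimpleZeroZ {γ : ℝ} (h : IsSimpleZeroZ γ) :
    ∃ W : ℂ → ℂ, Differentiable ℂ W ∧ W γ ≠ 0 ∧ (∀ z, xiLine z = (z - γ) * W z) ∧
      Fhat γ = 3 * ((-(deriv (logDeriv W) γ)).re -
        (2 * (γ ^ 2 - 1 / 4) / (γ ^ 2 + 1 / 4) ^ 2 +
          (deriv digamma (1 / 4 + I * γ / 2)).re / 4)) := by
  obtain ⟨h0, hd⟩ := h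
  have hX0 := xiLine_eq_zero_of_HardyZ h0
  set W := dslope xiLine γ with hWdef
  have hW : Differentiable ℂ W := by
    rw [← differentiableOn_univ]
    exact (differentiableOn_dslope Filter.univ_mem).2 differentiable_xiLine.differentiableOn
  have hXW : ∀ z, xiLine z = (z - γ) * W z := fun z => by
    have := sub_smul_dslope xiLine (γ : ℂ) z
    rw [hX0, sub_zero, smul_eq_mul] at this
    exact this.symm
  have hWoff : ∀ t : ℝ, t ≠ γ → (W t).im = 0 := fun t ht => by
    have h1 := hXW t
    rw [← ofReal_xiLine_re, ← ofReal_sub] at h1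
    have := congrArg im h1
    rw [ofReal_im, im_ofReal_mul] at this
    exact (mul_eq_zero.1 this.symm).resolve_left (sub_ne_zero.2 ht)
  have hWc : Continuous fun t : ℝ => (W t).im :=
    continuous_im.comp (hW.continuous.comp continuous_ofReal)
  have hWim : ∀ t : ℝ, (W t).im = 0 := fun t => by
    have hcl : IsClosed {t : ℝ | (W t).im = 0} := isClosed_eq hWc continuous_const
    have hsub : ({γ}ᶜ : Set ℝ) ⊆ {t : ℝ | (W t).im = 0} := fun t ht => hWoff t ht
    exact hcl.closure_subset_iff.2 hsub ((dense_compl_singleton γ) t)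
  have hWre : ∀ t : ℝ, ((W t).re : ℂ) = W t := fun t => by
    apply Complex.ext <;> simp [hWim t]
  set w : ℝ → ℝ := fun t => hardyAmplitude t * (W t).re with hw
  set l₀ : ℝ → ℝ := fun t =>
    -(2 * t / (t ^ 2 + 1 / 4)) + (digamma (1 / 4 + I * t / 2)).im / 2 with hl₀
  have hre : ∀ t : ℝ, HasDerivAt (fun t : ℝ => (W t).re) (deriv W t).re t := fun t =>
    (hW t).hasDerivAt.real_of_complex
  have hwc : Continuous w := by
    refine Continuous.mul ?_ (continuous_re.comp (hW.continuous.comp continuous_ofReal))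
    exact continuous_iff_continuousAt.2 fun t => (hasDerivAt_hardyAmplitude t).continuousAt
  have hsign : ∀ t, ∃ σ : ℝ, (σ = 1 ∨ σ = -1) ∧ HardyZ t = σ * ((t - γ) * w t) := fun t => by
    obtain ⟨σ, hσ, e⟩ := exists_HardyZ_eq t
    refine ⟨σ, hσ, ?_⟩
    rw [e, hXW, ← ofReal_sub, re_ofReal_mul]
    ring
  obtain ⟨hwγ, c, hc, hev⟩ := simple_zero_of_sign hwc.continuousAt hsign hd
  have hWγre : (W γ).re ≠ 0 := right_ne_zero_of_mul hwγ
  have hWγ : W γ ≠ 0 := fun h => hWγre (by rw [h, zero_re])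
  have hne : ∀ᶠ t : ℝ in 𝓝 γ, W t ≠ 0 :=
    (hW.continuous.comp continuous_ofReal).continuousAt.eventually_ne hWγ
  have hLopen : IsOpen {z : ℂ | W z ≠ 0} := isOpen_ne_fun hW.continuous continuous_const
  have hL : DifferentiableOn ℂ (logDeriv W) {z | W z ≠ 0} :=
    (hW.deriv.differentiableOn).div hW.differentiableOn fun z hz => hz
  refine ⟨W, hW, hWγ, hXW, ?_⟩
  have hmain := schwarzian_of_simple_zero (l := fun t => l₀ t + (logDeriv W t).re)
    (l₁ := fun t => 2 * (t ^ 2 - 1 / 4) / (t ^ 2 + 1 / 4) ^ 2 +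
      (deriv digamma (1 / 4 + I * t / 2)).re / 4 + (deriv (logDeriv W) t).re) hc hev ?_ ?_ ?_ hwγ
  · rw [Fhat, hmain, neg_re]
    ring
  · filter_upwards [hne] with t ht
    refine ((hasDerivAt_hardyAmplitude t).mul (hre t)).congr_deriv ?_
    have e : (deriv W t).re = (W t).re * (logDeriv W t).re := by
      rw [← re_ofReal_mul, hWre, logDeriv_apply, mul_div_cancel₀ _ ht]
    simp only [hw, hl₀]
    rw [e]
    ring
  · filter_upwards [hne] with t ht
    exact (hasDerivAt_logDeriv_hardyAmplitude t).add
      (hL.differentiableAt (hLopen.mem_nhds ht)).hasDerivAt.real_of_complex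
  · have hq : ∀ t : ℝ, (t ^ 2 + 1 / 4) ^ 2 ≠ 0 := fun t => by positivity
    have h2 : ContinuousAt (deriv (logDeriv W)) γ :=
      (hL.deriv hLopen).continuousOn.continuousAt (hLopen.mem_nhds hWγ)
    refine (((Continuous.div (by fun_prop) (by fun_prop) hq).add
      ((continuous_re.comp continuous_deriv_digamma_line).div_const 4)).continuousAt).add ?_
    exact continuous_re.continuousAt.comp (h2.comp continuous_ofReal.continuousAt)

end

/-- Under RH, for every pair of distinct simple positive real zeros of Hardy's
Z-function, the value `ĝ_{γ₁,γ₂}` is strictly positive. -/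
theorem ghat_pos (hRH : RiemannHypothesis) (γ₁ γ₂ : ℝ)
    (h₁ : 0 < γ₁) (h₂ : 0 < γ₂) (hne : γ₁ ≠ γ₂)
    (hs₁ : IsSimpleZeroZ γ₁) (hs₂ : IsSimpleZeroZ γ₂) :
    0 < ghat γ₁ γ₂ := by
  obtain ⟨F⟩ := nonempty_xiLine_factorization hRH
  obtain ⟨W₁, hW₁, hWγ₁, hXW₁, hF₁⟩ := exists_cofactor_of_isSimpleZeroZ hs₁
  obtain ⟨W₂, hW₂, hWγ₂, hXW₂, hF₂⟩ := exists_cofactor_of_isSimpleZeroZ hs₂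
  have hten₁ := ten_le_of_xiLine_eq_zero F h₁ (xiLine_eq_zero_of_HardyZ hs₁.1)
  have hten₂ := ten_le_of_xiLine_eq_zero F h₂ (xiLine_eq_zero_of_HardyZ hs₂.1)
  have hA₁ := F.simple_zero_ge xiLine_neg h₁ h₂ hne hW₁ hWγ₁ hXW₁ hW₂ hWγ₂ hXW₂
  have hA₂ := F.simple_zero_ge xiLine_neg h₂ h₁ hne.symm hW₂ hWγ₂ hXW₂ hW₁ hWγ₁ hXW₁
  have hf₁ := four_div_sq_le hten₁
  have hf₂ := four_div_sq_le hten₂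
  have hh₁ := logDeriv_hardyAmplitude_deriv_lt hten₁
  have hh₂ := logDeriv_hardyAmplitude_deriv_lt hten₂
  have hd : 0 < (γ₁ - γ₂) ^ 2 := by
    have := sub_ne_zero.2 hne
    positivity
  have hmean : 4 / (γ₁ ^ 2 + γ₂ ^ 2) ≤ 1 / γ₁ ^ 2 + 1 / γ₂ ^ 2 := by
    rw [div_add_div _ _ (by positivity) (by positivity),
      div_le_div_iff₀ (by positivity) (by positivity)]
    nlinarith [sq_nonneg (γ₁ ^ 2 - γ₂ ^ 2)]
  have e1 : (γ₂ - γ₁) ^ 2 = (γ₁ - γ₂) ^ 2 := by ring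
  have e2 : γ₂ ^ 2 + γ₁ ^ 2 = γ₁ ^ 2 + γ₂ ^ 2 := add_comm _ _
  rw [e1, e2] at hA₂
  have e3 : ∀ a b : ℝ, a / b = a * (1 / b) := fun a b => div_eq_mul_one_div a b
  rw [e3 4] at hf₁ hf₂ hmean
  rw [e3 2 (γ₁ ^ 2)] at hh₁
  rw [e3 2 (γ₂ ^ 2)] at hh₂
  rw [e3 2 (γ₁ ^ 2 + γ₂ ^ 2)] at hA₁ hA₂
  rw [ghat, hF₁, hF₂]
  set B₁ := 2 * (γ₁ ^ 2 - 1 / 4) / (γ₁ ^ 2 + 1 / 4) ^ 2 +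
    (deriv digamma (1 / 4 + I * γ₁ / 2)).re / 4
  set B₂ := 2 * (γ₂ ^ 2 - 1 / 4) / (γ₂ ^ 2 + 1 / 4) ^ 2 +
    (deriv digamma (1 / 4 + I * γ₂ / 2)).re / 4
  have hsum : 2 * (1 / (γ₁ - γ₂) ^ 2) < (-(deriv (logDeriv W₁) γ₁)).re - B₁ +
      ((-(deriv (logDeriv W₂) γ₂)).re - B₂) := by linarith
  have hmul := mul_lt_mul_of_pos_left hsum hd
  have e4 : (γ₁ - γ₂) ^ 2 * (2 * (1 / (γ₁ - γ₂) ^ 2)) = 2 := by field_simp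
  linarith
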